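/- arXiv:1602.07944 — 2 statements merged into one kernel-verified Lean document; each statement's English description precedes it below -/
import Mathlib

section
/- Let u ≡ 11 (mod 12), v ≡ 1 or 5 (mod 6), and w ≡ 10 (mod 12) be positive integers. Then there exists a w-cyclic 3-GDP of type (vw)^u with J*(u×v×w,3,1) base blocks. -/
/-- `J(u×v×w,3,1) = ⌊uv·⌊vw(u−1)/2⌋/3⌋` (floor division on naturals). -/
def J (u v w : ℕ) : ℕ := u * v * (v * w * (u - 1) / 2) / 3

/-- The improved upper bound `J*(u×v×w,3,1)`. -/
def Jstar (u v w : ℕ) : ℕ :=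
  if (u = 3 ∧ v % 2 = 1 ∧ w % 4 = 0)
    ∨ (v % 2 = 1 ∧ w % 4 = 2 ∧ (u % 12 = 3 ∨ u % 12 = 6 ∨ u % 12 = 7 ∨ u % 12 = 10))
    ∨ ((v * w) % 12 = 6 ∧ w % 4 = 2 ∧ (u % 12 = 2 ∨ u % 12 = 11))
    ∨ (((u - 1) * v ^ 2 * w) % 6 = 4 ∧ u % 3 = 2)
    ∨ (w = 2 ∧ (u * (u - 1) * v ^ 2) % 12 = 8)
  then J u v w - 1 else J u v w

/-- A `w`-cyclic `k`-GDP of type `(vw)^u` with `b` base blocks: blocks on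
`I_u × I_v × Z_w` with groups `{i} × I_v × Z_w`; every block has size `k` and
meets each group in at most one point, every pair of points from distinct
groups lies in at most one block, the cyclic shift of the last coordinate
maps the block set onto itself, and (since every block orbit has length
exactly `w`) the number of base blocks being `b` means there are `w * b`
blocks in total. -/
def IsCyclicGDP (u v w k b : ℕ)
    (ℬ : Finset (Finset (Fin u × Fin v × ZMod w))) : Prop :=
  ℬ.card = w * b ∧
  (∀ B ∈ ℬ, B.card = k) ∧
  (∀ B ∈ ℬ, ∀ p ∈ B, ∀ q ∈ B, p ≠ q → p.1 ≠ q.1) ∧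
  (∀ p q : Fin u × Fin v × ZMod w, p.1 ≠ q.1 →
    (ℬ.filter (fun B => p ∈ B ∧ q ∈ B)).card ≤ 1) ∧
  (∀ B ∈ ℬ, B.image (fun p => (p.1, p.2.1, p.2.2 + 1)) ∈ ℬ)

/-- The directed difference from `p` to `q`: the two columns, and the difference of the
second coordinates. -/
def arrow {C Γ : Type} [AddCommGroup Γ] (p q : C × Γ) : C × C × Γ := (p.1, q.1, q.2 - p.2)

/-- `Packs E n`: there are `n` triples of points of `C × Γ` whose directed differences all lie
in `E` and are pairwise distinct. -/
def Packs {C Γ : Type} [AddCommGroup Γ] (E : Set (C × C × Γ)) (n : ℕ) : Prop :=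
  ∃ (ι : Type) (_ : Fintype ι) (f : ι → Fin 3 → C × Γ), Fintype.card ι = n ∧
    (∀ b i j, i ≠ j → arrow (f b i) (f b j) ∈ E) ∧
    ∀ b b' i i' j j', i ≠ j → i' ≠ j' →
      arrow (f b i) (f b j) = arrow (f b' i') (f b' j') → b = b' ∧ i = i' ∧ j = j'

namespace Packs

variable {C C' Γ Γ' : Type} [AddCommGroup Γ] [AddCommGroup Γ']

theorem mono {E E' : Set (C × C × Γ)} {n : ℕ} (h : Packs E n) (hE : E ⊆ E') : Packs E' n := by
  obtain ⟨ι, _, f, hc, h1, h2⟩ := h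
  exact ⟨ι, _, f, hc, fun b i j hij => hE (h1 b i j hij), h2⟩

theorem map {E : Set (C × C × Γ)} {E' : Set (C' × C' × Γ')} {n : ℕ} (h : Packs E n)
    (φ : C → C') (ψ : Γ →+ Γ')
    (hE : ∀ c d x, (c, d, x) ∈ E → (φ c, φ d, ψ x) ∈ E')
    (hinj : ∀ c d x c' d' x', (c, d, x) ∈ E → (c', d', x') ∈ E → φ c = φ c' → φ d = φ d' →
      ψ x = ψ x' → c = c' ∧ d = d' ∧ x = x') : Packs E' n := by
  obtain ⟨ι, _, f, hc, h1, h2⟩ := h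
  refine ⟨ι, _, fun b i => (φ (f b i).1, ψ (f b i).2), hc, fun b i j hij => ?_,
    fun b b' i i' j j' hij hij' he => ?_⟩
  · have := hE _ _ _ (h1 b i j hij)
    simpa [arrow] using this
  · simp only [arrow, Prod.mk.injEq, ← map_sub] at he
    obtain ⟨e1, e2, e3⟩ := hinj _ _ _ _ _ _ (h1 b i j hij) (h1 b' i' j' hij') he.1 he.2.1 he.2.2
    exact h2 _ _ _ _ _ _ hij hij' (by simp only [arrow, e1, e2, e3])

theorem map_injective {E : Set (C × C × Γ)} {E' : Set (C' × C' × Γ')} {n : ℕ} (h : Packs E n)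
    {φ : C → C'} {ψ : Γ →+ Γ'} (hφ : φ.Injective) (hψ : Function.Injective ψ)
    (hE : ∀ c d x, (c, d, x) ∈ E → (φ c, φ d, ψ x) ∈ E') : Packs E' n :=
  h.map φ ψ hE fun _ _ _ _ _ _ _ _ e1 e2 e3 => ⟨hφ e1, hφ e2, hψ e3⟩

theorem of_isEmpty : Packs (∅ : Set (C × C × Γ)) 0 :=
  ⟨Empty, inferInstance, fun b => b.elim, rfl, fun b => b.elim, fun b => b.elim⟩

theorem iUnion {κ : Type} [Fintype κ] {E : κ → Set (C × C × Γ)} {n : κ → ℕ}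
    (h : ∀ k, Packs (E k) (n k)) (hd : ∀ k k' a, a ∈ E k → a ∈ E k' → k = k') :
    Packs (⋃ k, E k) (∑ k, n k) := by
  choose ι hι f hc h1 h2 using h
  refine ⟨Σ k, ι k, inferInstance, fun b => f b.1 b.2, by simp [hc], fun b i j hij =>
    Set.mem_iUnion.2 ⟨b.1, h1 b.1 b.2 i j hij⟩, ?_⟩
  rintro ⟨k, b⟩ ⟨k', b'⟩ i i' j j' hij hij' he
  obtain rfl : k = k' := hd _ _ _ (h1 k b i j hij) (he ▸ h1 k' b' i' j' hij')
  obtain ⟨rfl, e⟩ := h2 k b b' i i' j j' hij hij' he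
  exact ⟨rfl, e⟩

theorem iUnion_const {κ : Type} [Fintype κ] {E : κ → Set (C × C × Γ)} {n : ℕ}
    (h : ∀ k, Packs (E k) n) (hd : ∀ k k' a, a ∈ E k → a ∈ E k' → k = k') :
    Packs (⋃ k, E k) (Fintype.card κ * n) := by
  simpa using iUnion h hd

theorem union {E E' : Set (C × C × Γ)} {n n' : ℕ} (h : Packs E n) (h' : Packs E' n')
    (hd : ∀ a, a ∈ E → a ∉ E') : Packs (E ∪ E') (n + n') := by
  have := iUnion (κ := Bool) (E := fun k => cond k E E') (n := fun k => cond k n n')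
    (by rintro (_ | _) <;> assumption)
    (by
      rintro (_ | _) (_ | _) a h1 h2
      · rfl
      · exact absurd h1 (hd a h2)
      · exact absurd h2 (hd a h1)
      · rfl)
  simpa [Set.union_eq_iUnion] using this

theorem unfold {A : Type} [AddCommGroup A] [Fintype A] {E : Set (C × C × Γ × A)} {n : ℕ}
    (h : Packs E n) :
    Packs {a : (C × A) × (C × A) × Γ | (a.1.1, a.2.1.1, a.2.2, a.2.1.2 - a.1.2) ∈ E}
      (n * Fintype.card A) := by
  obtain ⟨ι, _, f, hc, h1, h2⟩ := h
  refine ⟨ι × A, inferInstance, fun b i => (((f b.1 i).1, b.2 + (f b.1 i).2.2), (f b.1 i).2.1),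
    by simp [hc], fun b i j hij => ?_, ?_⟩
  · have := h1 b.1 i j hij
    simpa only [arrow, Set.mem_ofPred_eq, add_sub_add_left_eq_sub] using! this
  · rintro ⟨b, a⟩ ⟨b', a'⟩ i i' j j' hij hij' he
    simp only [arrow, Prod.mk.injEq] at he
    obtain ⟨⟨e1, e2⟩, ⟨e3, e4⟩, e5⟩ := he
    obtain ⟨rfl, rfl, rfl⟩ := h2 b b' i i' j j' hij hij' (by
      simp only [arrow, Prod.mk.injEq, e1, e3, true_and]
      refine Prod.ext e5 ?_
      have := congrArg₂ (· - ·) e4 e2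
      simpa using this)
    simpa using e2

theorem inflate {A : Type} [AddCommGroup A] [Fintype A] (hA : ∀ x : A, x + x = 0 → x = 0)
    {E : Set (C × C × Γ)} {n : ℕ} (h : Packs E n) :
    Packs {a : C × C × Γ × A | (a.1, a.2.1, a.2.2.1) ∈ E} (n * Fintype.card A) := by
  obtain ⟨ι, _, f, hc, h1, h2⟩ := h
  refine ⟨ι × A, inferInstance, fun b i => ((f b.1 i).1, (f b.1 i).2, i.val • b.2),
    by simp [hc], fun b i j hij => ?_, ?_⟩
  · have := h1 b.1 i j hij
    simpa [arrow] using this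
  · rintro ⟨b, x⟩ ⟨b', x'⟩ i i' j j' hij hij' he
    simp only [arrow, Prod.mk.injEq, Prod.mk_sub_mk] at he
    obtain ⟨e1, e2, e3, e4⟩ := he
    obtain ⟨rfl, rfl, rfl⟩ := h2 b b' i i' j j' hij hij' (by simp only [arrow, e1, e2, e3])
    have key : x - x' = 0 := by
      have e5 : j.val • (x - x') = i.val • (x - x') := by
        rw [smul_sub, smul_sub]
        exact sub_eq_sub_iff_sub_eq_sub.1 e4
      have h2 : ∀ y : A, (2 : ℕ) • y = 0 → y = 0 := fun y hy => hA y (by rwa [two_nsmul] at hy)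
      have h21 : ∀ y : A, (2 : ℕ) • y = y → y = 0 := fun y hy => by
        rw [two_nsmul] at hy; simpa using hy
      fin_cases i <;> fin_cases j <;> simp at hij e5 <;>
        first
          | exact e5
          | exact e5.symm
          | exact h2 _ e5
          | exact h2 _ e5.symm
          | exact h21 _ e5
          | exact h21 _ e5.symm
    exact ⟨by rw [sub_eq_zero.1 key], rfl, rfl⟩

/-- Replacing every triple of a packing on plain columns by a copy of a packing on three
columns. -/
theorem compose {B : Set (C × C × Unit)} {W : Set Γ} {n n' : ℕ} (hB : Packs B n)
    (hW : Packs {a : Fin 3 × Fin 3 × Γ | a.1 ≠ a.2.1 ∧ a.2.2 ∈ W} n') :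
    Packs {a : C × C × Γ | (a.1, a.2.1, ()) ∈ B ∧ a.2.2 ∈ W} (n * n') := by
  obtain ⟨ι, _, f, rfl, h1, h2⟩ := hB
  have key : ∀ b b' i i' j j', i ≠ j → i' ≠ j' → (f b i).1 = (f b' i').1 →
      (f b j).1 = (f b' j').1 → b = b' ∧ i = i' ∧ j = j' := fun b b' i i' j j' hij hij' e1 e2 =>
    h2 b b' i i' j j' hij hij' (by simp [arrow, e1, e2])
  have := iUnion_const (κ := ι)
    (E := fun b => {a : C × C × Γ | ∃ i j, i ≠ j ∧ (f b i).1 = a.1 ∧ (f b j).1 = a.2.1 ∧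
      a.2.2 ∈ W}) (n := n')
    (fun b => hW.map (fun i => (f b i).1) (AddMonoidHom.id Γ)
      (fun c d x h => ⟨c, d, h.1, rfl, rfl, h.2⟩)
      (fun c d x c' d' x' h h' e1 e2 e3 => by
        obtain ⟨-, rfl, rfl⟩ := key b b c c' d d' h.1 h'.1 e1 e2
        exact ⟨rfl, rfl, e3⟩))
    (fun b b' a => by
      rintro ⟨i, j, hij, e1, e2, -⟩ ⟨i', j', hij', e1', e2', -⟩
      exact (key b b' i i' j j' hij hij' (e1.trans e1'.symm) (e2.trans e2'.symm)).1)
  refine this.mono ?_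
  rintro ⟨c, d, x⟩ hx
  obtain ⟨b, i, j, hij, e1, e2, hw⟩ := Set.mem_iUnion.1 hx
  simp only at e1 e2 hw
  subst e1 e2
  exact ⟨h1 b i j hij, hw⟩

end Packs

theorem exists_isCyclicGDP_of_packs {u v w n : ℕ} [NeZero w]
    (h : Packs {a : (Fin u × Fin v) × (Fin u × Fin v) × ZMod w | a.1.1 ≠ a.2.1.1} n) :
    ∃ ℬ : Finset (Finset (Fin u × Fin v × ZMod w)), IsCyclicGDP u v w 3 n ℬ := by
  obtain ⟨ι, _, f, rfl, h1, h2⟩ := h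
  classical
  let pt : ι × ZMod w → Fin 3 → Fin u × Fin v × ZMod w := fun b i =>
    ((f b.1 i).1.1, (f b.1 i).1.2, (f b.1 i).2 + b.2)
  have hgrp : ∀ b i j, i ≠ j → (pt b i).1 ≠ (pt b j).1 := fun b i j hij => h1 b.1 i j hij
  have hpt : ∀ b, (pt b).Injective := fun b i j hij => by
    by_contra hne
    exact hgrp b i j hne (by rw [hij])
  have huniq : ∀ b b' i i' j j', i ≠ j → i' ≠ j' → pt b i = pt b' i' → pt b j = pt b' j' →
      b = b' := by
    rintro ⟨b, t⟩ ⟨b', t'⟩ i i' j j' hij hij' e1 e2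
    simp only [pt, Prod.mk.injEq] at e1 e2
    obtain ⟨rfl, rfl, rfl⟩ := h2 b b' i i' j j' hij hij' (by
      simp only [arrow, Prod.mk.injEq]
      refine ⟨Prod.ext e1.1 e1.2.1, Prod.ext e2.1 e2.2.1, ?_⟩
      have := congrArg₂ (· - ·) e2.2.2 e1.2.2
      simpa using this)
    simpa using e1.2.2
  let blk : ι × ZMod w → Finset (Fin u × Fin v × ZMod w) := fun b => Finset.univ.image (pt b)
  have hmem : ∀ b p, p ∈ blk b ↔ ∃ i, pt b i = p := fun b p => by simp [blk]
  have hblk : blk.Injective := fun b b' hb => by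
    obtain ⟨i, hi⟩ := (hmem b' _).1 (hb ▸ (hmem b _).2 ⟨0, rfl⟩)
    obtain ⟨j, hj⟩ := (hmem b' _).1 (hb ▸ (hmem b _).2 ⟨1, rfl⟩)
    refine huniq b b' 0 i 1 j (by decide) ?_ hi.symm hj.symm
    rintro rfl
    exact absurd (hpt b (hi.symm.trans hj)) (by decide)
  refine ⟨Finset.univ.image blk, ?_, ?_, ?_, ?_, ?_⟩
  · rw [Finset.card_image_of_injective _ hblk]
    simp [ZMod.card, mul_comm]
  · intro B hB
    obtain ⟨b, -, rfl⟩ := Finset.mem_image.1 hB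
    rw [Finset.card_image_of_injective _ (hpt b)]
    rfl
  · intro B hB p hp q hq hpq
    obtain ⟨b, -, rfl⟩ := Finset.mem_image.1 hB
    obtain ⟨i, rfl⟩ := (hmem b p).1 hp
    obtain ⟨j, rfl⟩ := (hmem b q).1 hq
    exact hgrp b i j (fun h => hpq (by rw [h]))
  · intro p q hpq
    rw [Finset.card_le_one]
    intro B hB B' hB'
    simp only [Finset.mem_filter, Finset.mem_image, Finset.mem_univ, true_and] at hB hB'
    obtain ⟨⟨b, rfl⟩, hp, hq⟩ := hB
    obtain ⟨⟨b', rfl⟩, hp', hq'⟩ := hB'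
    obtain ⟨i, hi⟩ := (hmem _ _).1 hp
    obtain ⟨j, hj⟩ := (hmem _ _).1 hq
    obtain ⟨i', hi'⟩ := (hmem _ _).1 hp'
    obtain ⟨j', hj'⟩ := (hmem _ _).1 hq'
    rw [huniq b b' i i' j j' ?_ ?_ (hi.trans hi'.symm) (hj.trans hj'.symm)]
    · rintro rfl; exact hpq (by rw [← hi, ← hj])
    · rintro rfl; exact hpq (by rw [← hi', ← hj'])
  · intro B hB
    obtain ⟨⟨b, t⟩, -, rfl⟩ := Finset.mem_image.1 hB
    refine Finset.mem_image.2 ⟨(b, t + 1), Finset.mem_univ _, ?_⟩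
    simp only [blk, Finset.image_image]
    congr 1
    funext i
    simp [pt, add_assoc]

/-- The three points of `ℕ × ℤ/N` encoded by `(a, b, c, x, y)`: columns `a`, `b`, `c` with second
coordinates `0`, `x`, `y`. -/
def codedPoint (t : ℕ × ℕ × ℕ × ℕ × ℕ) : Fin 3 → ℕ × ℕ :=
  ![(t.1, 0), (t.2.1, t.2.2.2.1), (t.2.2.1, t.2.2.2.2)]

/-- The directed difference modulo `N`, computed with natural numbers. -/
def codedArrow (N : ℕ) (p q : ℕ × ℕ) : ℕ × ℕ × ℕ := (p.1, q.1, (q.2 + (N - 1) * p.2) % N)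

/-- The six directed differences of a coded triple. -/
def codedArrows (N : ℕ) (t : ℕ × ℕ × ℕ × ℕ × ℕ) : List (ℕ × ℕ × ℕ) :=
  let p := codedPoint t
  [codedArrow N (p 0) (p 1), codedArrow N (p 1) (p 0), codedArrow N (p 0) (p 2),
    codedArrow N (p 2) (p 0), codedArrow N (p 1) (p 2), codedArrow N (p 2) (p 1)]

/-- Whether the list has no repetition and avoids the set bits of the mask. -/
def distinctFrom : ℕ → List ℕ → Bool
  | _, [] => true
  | m, k :: l => bif m.testBit k then false else distinctFrom (m ||| 1 <<< k) l

theorem distinctFrom_spec (l : List ℕ) (m : ℕ) (h : distinctFrom m l = true) :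
    l.Nodup ∧ ∀ k ∈ l, m.testBit k = false := by
  induction l generalizing m with
  | nil => simp
  | cons k l ih =>
    simp only [distinctFrom] at h
    cases hk : m.testBit k
    · rw [hk] at h
      obtain ⟨h1, h2⟩ := ih _ h
      have h3 : ∀ i ∈ l, m.testBit i = false ∧ i ≠ k := fun i hi => by
        have := h2 i hi
        rw [Nat.testBit_or, Bool.or_eq_false_iff] at this
        refine ⟨this.1, ?_⟩
        rintro rfl
        simpa [Nat.testBit_shiftLeft] using this.2
      refine ⟨List.nodup_cons.2 ⟨fun hkl => (h3 k hkl).2 rfl, h1⟩, fun i hi => ?_⟩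
      rcases List.mem_cons.1 hi with rfl | hi
      · exact hk
      · exact (h3 i hi).1
    · rw [hk] at h
      simp at h

/-- Whether the directed differences of the coded triples satisfy `P` and are distinct. -/
def packsCheck (N : ℕ) (P : ℕ → ℕ → ℕ → Bool) (l : List (ℕ × ℕ × ℕ × ℕ × ℕ)) : Bool :=
  let k := l.flatMap (codedArrows N)
  k.all (fun a => P a.1 a.2.1 a.2.2) &&
    distinctFrom 0 (k.map fun a => (a.1 * 64 + a.2.1) * N + a.2.2)

theorem codedArrow_mem (N : ℕ) (t : ℕ × ℕ × ℕ × ℕ × ℕ) {i j : Fin 3} (h : i ≠ j) :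
    codedArrow N (codedPoint t i) (codedPoint t j) ∈ codedArrows N t := by
  fin_cases i <;> fin_cases j <;> simp [codedArrows] at h ⊢

theorem codedArrow_injective {N : ℕ} {t : ℕ × ℕ × ℕ × ℕ × ℕ} (ht : (codedArrows N t).Nodup)
    {i j i' j' : Fin 3} (h : i ≠ j) (h' : i' ≠ j')
    (he : codedArrow N (codedPoint t i) (codedPoint t j) =
      codedArrow N (codedPoint t i') (codedPoint t j')) : i = i' ∧ j = j' := by
  simp only [codedArrows, List.nodup_cons, List.mem_cons, not_or] at ht
  obtain ⟨⟨h1, h2, h3, h4, h5, -⟩, ⟨h6, h7, h8, h9, -⟩, ⟨h10, h11, h12, -⟩, ⟨h13, h14, -⟩,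
    ⟨h15, -⟩, -⟩ := ht
  fin_cases i <;> fin_cases j <;> fin_cases i' <;> fin_cases j' <;>
    first
      | exact ⟨rfl, rfl⟩
      | exact absurd rfl h
      | exact absurd rfl h'
      | exact (by assumption : ¬ _ = _).elim he
      | exact (by assumption : ¬ _ = _).elim he.symm

theorem Packs.of_check {N : ℕ} [NeZero N] {P : ℕ → ℕ → ℕ → Bool}
    {l : List (ℕ × ℕ × ℕ × ℕ × ℕ)} (h : packsCheck N P l = true) :
    Packs {a : ℕ × ℕ × ZMod N | P a.1 a.2.1 a.2.2.val = true} l.length := by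
  simp only [packsCheck, Bool.and_eq_true, List.all_eq_true] at h
  obtain ⟨hP, hd⟩ := h
  obtain ⟨hn, hdis⟩ := List.nodup_flatMap.1 (List.Nodup.of_map _ (distinctFrom_spec _ _ hd).1)
  let pt : Fin l.length → Fin 3 → ℕ × ZMod N := fun b i =>
    ((codedPoint l[b] i).1, ((codedPoint l[b] i).2 : ZMod N))
  have harrow : ∀ b i j, arrow (pt b i) (pt b j) =
      ((codedPoint l[b] i).1, (codedPoint l[b] j).1,
        ((codedArrow N (codedPoint l[b] i) (codedPoint l[b] j)).2.2 : ZMod N)) := fun b i j => by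
    have hN : ((N - 1 : ℕ) : ZMod N) = -1 := by
      rw [Nat.cast_sub NeZero.one_le]; simp
    simp only [arrow, pt, codedArrow, ZMod.natCast_mod, Nat.cast_add, Nat.cast_mul, hN]
    congr 2
    ring
  have hval : ∀ p q : ℕ × ℕ,
      ((codedArrow N p q).2.2 : ZMod N).val = (codedArrow N p q).2.2 := fun p q => by
    rw [ZMod.val_natCast, codedArrow, Nat.mod_mod]
  refine ⟨Fin l.length, inferInstance, pt, Fintype.card_fin _, fun b i j hij => ?_,
    fun b b' i i' j j' hij hij' he => ?_⟩
  · rw [harrow]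
    have := hP _ (List.mem_flatMap.2 ⟨l[b], List.getElem_mem _, codedArrow_mem N _ hij⟩)
    simpa only [Set.mem_ofPred_eq, hval] using! this
  · have hk : codedArrow N (codedPoint l[b] i) (codedPoint l[b] j) =
        codedArrow N (codedPoint l[b'] i') (codedPoint l[b'] j') := by
      rw [harrow, harrow, Prod.mk.injEq, Prod.mk.injEq] at he
      refine Prod.ext he.1 (Prod.ext he.2.1 ?_)
      have := congrArg ZMod.val he.2.2
      rwa [hval, hval] at this
    obtain rfl : b = b' := by
      have hdis' := List.pairwise_iff_getElem.1 hdis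
      have hm := codedArrow_mem N l[b] hij
      have hm' := codedArrow_mem N l[b'] hij'
      rcases lt_trichotomy b b' with hlt | heq | hlt
      · exact (hdis' b b' b.2 b'.2 hlt hm (hk ▸ hm')).elim
      · exact heq
      · exact (hdis' b' b b'.2 b.2 hlt hm' (hk ▸ hm)).elim
    exact ⟨rfl, codedArrow_injective (hn _ (List.getElem_mem _)) hij hij' hk⟩

/-- Pairs of columns below `n` that are not both below `h`. -/
def offHole (h n c d : ℕ) : Bool := c < n && d < n && (h ≤ c || h ≤ d)

/-- Fifteen triangles decomposing the complete graph on `11` points minus that on `5` points. -/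
def triangles : List (ℕ × ℕ × ℕ × ℕ × ℕ) :=
  [(0, 5, 8, 0, 0), (0, 6, 10, 0, 0), (0, 7, 9, 0, 0), (1, 5, 7, 0, 0), (1, 6, 8, 0, 0),
   (1, 9, 10, 0, 0), (2, 5, 6, 0, 0), (2, 7, 10, 0, 0), (2, 8, 9, 0, 0), (3, 5, 9, 0, 0),
   (3, 6, 7, 0, 0), (3, 8, 10, 0, 0), (4, 5, 10, 0, 0), (4, 6, 9, 0, 0), (4, 7, 8, 0, 0)]

theorem packs_triangles :
    Packs {a : ℕ × ℕ × ZMod 1 | (offHole 5 11 a.1 a.2.1 && a.1 != a.2.1) = true} 15 :=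
  Packs.of_check (P := fun c d _ => offHole 5 11 c d && c != d) (l := triangles)
    (by decide +kernel)

/-- The blocks of a `3`-GDD of type `4^3`. -/
def blocks444 : List (ℕ × ℕ × ℕ × ℕ × ℕ) :=
  [(0, 4, 8, 0, 0), (0, 5, 10, 0, 0), (0, 6, 11, 0, 0), (0, 7, 9, 0, 0), (1, 4, 11, 0, 0),
   (1, 5, 9, 0, 0), (1, 6, 8, 0, 0), (1, 7, 10, 0, 0), (2, 4, 9, 0, 0), (2, 5, 11, 0, 0),
   (2, 6, 10, 0, 0), (2, 7, 8, 0, 0), (3, 4, 10, 0, 0), (3, 5, 8, 0, 0), (3, 6, 9, 0, 0),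
   (3, 7, 11, 0, 0)]

/-- The blocks of a `3`-GDD of type `4^4`. -/
def blocks4444 : List (ℕ × ℕ × ℕ × ℕ × ℕ) :=
  [(0, 4, 15, 0, 0), (0, 5, 11, 0, 0), (0, 6, 10, 0, 0), (0, 7, 13, 0, 0), (0, 8, 12, 0, 0),
   (0, 9, 14, 0, 0), (1, 4, 10, 0, 0), (1, 5, 14, 0, 0), (1, 6, 12, 0, 0), (1, 7, 11, 0, 0),
   (1, 8, 15, 0, 0), (1, 9, 13, 0, 0), (2, 4, 8, 0, 0), (2, 5, 15, 0, 0), (2, 6, 13, 0, 0),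
   (2, 7, 9, 0, 0), (2, 10, 14, 0, 0), (2, 11, 12, 0, 0), (3, 4, 14, 0, 0), (3, 5, 9, 0, 0),
   (3, 6, 8, 0, 0), (3, 7, 12, 0, 0), (3, 10, 13, 0, 0), (3, 11, 15, 0, 0), (4, 9, 12, 0, 0),
   (4, 11, 13, 0, 0), (5, 8, 13, 0, 0), (5, 10, 12, 0, 0), (6, 9, 15, 0, 0), (6, 11, 14, 0, 0),
   (7, 8, 14, 0, 0), (7, 10, 15, 0, 0)]

theorem packs_blocks444 :
    Packs {a : ℕ × ℕ × ZMod 1 | (offHole 0 12 a.1 a.2.1 && a.1 / 4 != a.2.1 / 4) = true} 16 :=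
  Packs.of_check (P := fun c d _ => offHole 0 12 c d && c / 4 != d / 4) (l := blocks444)
    (by decide +kernel)

theorem packs_blocks4444 :
    Packs {a : ℕ × ℕ × ZMod 1 | (offHole 0 16 a.1 a.2.1 && a.1 / 4 != a.2.1 / 4) = true} 32 :=
  Packs.of_check (P := fun c d _ => offHole 0 16 c d && c / 4 != d / 4) (l := blocks4444)
    (by decide +kernel)

/-- Triples over `ℤ/2` on `23` columns covering what is not inside the first `11` columns. -/
def triples23 : List (ℕ × ℕ × ℕ × ℕ × ℕ) :=
  [(0, 11, 17, 0, 1), (0, 11, 18, 1, 1), (0, 12, 13, 0, 0), (0, 12, 22, 1, 0), (0, 13, 21, 1, 1),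
   (0, 14, 16, 0, 0), (0, 14, 20, 1, 0), (0, 15, 19, 1, 1), (0, 15, 20, 0, 1), (0, 16, 21, 1, 0),
   (0, 17, 19, 0, 0), (0, 18, 22, 0, 1), (1, 11, 13, 0, 1), (1, 11, 20, 1, 1), (1, 12, 15, 1, 0),
   (1, 12, 18, 0, 1), (1, 13, 19, 0, 1), (1, 14, 16, 1, 0), (1, 14, 20, 0, 0), (1, 15, 22, 1, 1),
   (1, 16, 17, 1, 1), (1, 17, 21, 0, 1), (1, 18, 22, 0, 0), (1, 19, 21, 0, 0), (2, 11, 13, 1, 1),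
   (2, 11, 21, 0, 1), (2, 12, 14, 1, 0), (2, 12, 22, 0, 0), (2, 13, 16, 0, 1), (2, 14, 18, 1, 1),
   (2, 15, 18, 1, 0), (2, 15, 22, 0, 1), (2, 16, 20, 0, 1), (2, 17, 19, 1, 0), (2, 17, 21, 0, 0),
   (2, 19, 20, 1, 0), (3, 11, 14, 0, 1), (3, 11, 15, 1, 1), (3, 12, 13, 0, 1), (3, 12, 19, 1, 1),
   (3, 13, 20, 0, 0), (3, 14, 17, 0, 0), (3, 15, 16, 0, 0), (3, 16, 20, 1, 1), (3, 17, 18, 1, 1),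
   (3, 18, 21, 0, 1), (3, 19, 22, 0, 1), (3, 21, 22, 0, 0), (4, 11, 19, 1, 0), (4, 11, 22, 0, 1),
   (4, 12, 17, 0, 0), (4, 12, 20, 1, 0), (4, 13, 14, 0, 0), (4, 13, 21, 1, 0), (4, 14, 21, 1, 1),
   (4, 15, 16, 1, 0), (4, 15, 19, 0, 1), (4, 16, 18, 1, 1), (4, 17, 18, 1, 0), (4, 20, 22, 1, 0),
   (5, 11, 15, 1, 0), (5, 11, 17, 0, 0), (5, 12, 15, 1, 1), (5, 12, 21, 0, 1), (5, 13, 16, 0, 0),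
   (5, 13, 20, 1, 0), (5, 14, 18, 0, 1), (5, 14, 19, 1, 1), (5, 16, 18, 1, 0), (5, 17, 22, 1, 1),
   (5, 19, 22, 0, 0), (5, 20, 21, 1, 0), (6, 11, 19, 0, 0), (6, 11, 20, 1, 0), (6, 12, 16, 0, 1),
   (6, 12, 17, 1, 0), (6, 13, 19, 1, 1), (6, 13, 22, 0, 0), (6, 14, 15, 1, 1), (6, 14, 21, 0, 1),
   (6, 15, 17, 0, 1), (6, 16, 22, 0, 1), (6, 18, 20, 1, 1), (6, 18, 21, 0, 0), (7, 11, 16, 0, 0),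
   (7, 11, 21, 1, 1), (7, 12, 18, 0, 0), (7, 12, 20, 1, 1), (7, 13, 14, 1, 0), (7, 13, 15, 0, 0),
   (7, 14, 22, 1, 0), (7, 15, 17, 1, 1), (7, 16, 19, 1, 0), (7, 17, 22, 0, 1), (7, 18, 19, 1, 1),
   (7, 20, 21, 0, 0), (8, 11, 12, 0, 1), (8, 11, 14, 1, 1), (8, 12, 21, 0, 0), (8, 13, 18, 1, 1),
   (8, 13, 22, 0, 1), (8, 14, 19, 0, 1), (8, 15, 18, 0, 0), (8, 15, 21, 1, 1), (8, 16, 17, 1, 0),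
   (8, 16, 22, 0, 0), (8, 17, 20, 1, 1), (8, 19, 20, 0, 0), (9, 11, 12, 0, 0), (9, 11, 18, 1, 0),
   (9, 12, 19, 1, 0), (9, 13, 17, 1, 1), (9, 13, 18, 0, 1), (9, 14, 15, 0, 1), (9, 14, 22, 1, 1),
   (9, 15, 21, 0, 1), (9, 16, 19, 1, 1), (9, 16, 21, 0, 0), (9, 17, 20, 0, 1), (9, 20, 22, 0, 0),
   (10, 11, 16, 1, 0), (10, 11, 22, 0, 0), (10, 12, 14, 0, 0), (10, 12, 16, 1, 1),
   (10, 13, 15, 1, 0), (10, 13, 17, 0, 1), (10, 14, 17, 1, 0), (10, 15, 20, 1, 1),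
   (10, 18, 19, 0, 1), (10, 18, 20, 1, 0), (10, 19, 21, 0, 1), (10, 21, 22, 0, 1)]

theorem packs_triples23 :
    Packs {a : ℕ × ℕ × ZMod 2 | (offHole 11 23 a.1 a.2.1 && a.1 != a.2.1) = true} 132 :=
  Packs.of_check (P := fun c d _ => offHole 11 23 c d && c != d) (l := triples23)
    (by decide +kernel)

/-- A permutation of order three of the columns below `35`. -/
def rotateColumn (c : ℕ) : ℕ :=
  if c < 9 then c / 3 * 3 + (c + 1) % 3
  else if c < 11 then c else (c - 2) / 3 * 3 + 2 + (c - 1) % 3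

/-- Representatives of the orbits of length three under `rotateColumn`. -/
def longOrbits35 : List (ℕ × ℕ × ℕ × ℕ × ℕ) :=
  [(0, 11, 13, 0, 0), (0, 11, 33, 1, 1), (0, 12, 16, 0, 1), (0, 12, 32, 1, 0), (0, 13, 31, 1, 0),
   (0, 14, 24, 1, 1), (0, 14, 26, 0, 1), (0, 15, 16, 1, 0), (0, 15, 24, 0, 0), (0, 17, 23, 1, 0),
   (0, 17, 30, 0, 0), (0, 18, 19, 1, 0), (0, 18, 22, 0, 1), (0, 19, 28, 1, 0), (0, 20, 21, 0, 1),
   (0, 20, 27, 1, 1), (0, 21, 31, 0, 1), (0, 22, 33, 0, 0), (0, 23, 29, 1, 1), (0, 25, 26, 1, 0),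
   (0, 25, 28, 0, 1), (0, 27, 34, 0, 1), (0, 29, 32, 0, 1), (0, 30, 34, 1, 0), (3, 11, 13, 1, 0),
   (3, 11, 21, 0, 0), (3, 12, 19, 0, 1), (3, 12, 24, 1, 0), (3, 13, 15, 1, 0), (3, 14, 20, 0, 1),
   (3, 14, 27, 1, 0), (3, 15, 34, 1, 1), (3, 16, 18, 1, 1), (3, 16, 19, 0, 0), (3, 17, 23, 1, 1),
   (3, 17, 24, 0, 1), (3, 18, 29, 0, 1), (3, 20, 31, 0, 0), (3, 21, 25, 1, 0), (3, 22, 31, 1, 1),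
   (3, 22, 33, 0, 1), (3, 23, 34, 0, 0), (3, 25, 30, 1, 1), (3, 26, 30, 0, 0), (3, 26, 32, 1, 1),
   (3, 27, 29, 1, 0), (3, 28, 32, 0, 0), (3, 28, 33, 1, 0), (6, 11, 25, 1, 0), (6, 11, 30, 0, 0),
   (6, 12, 18, 0, 1), (6, 12, 24, 1, 1), (6, 13, 17, 1, 1), (6, 13, 18, 0, 0), (6, 14, 29, 1, 0),
   (6, 14, 31, 0, 1), (6, 15, 22, 0, 1), (6, 15, 32, 1, 1), (6, 16, 23, 1, 0), (6, 16, 27, 0, 0),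
   (6, 17, 29, 0, 1), (6, 19, 24, 1, 0), (6, 19, 32, 0, 0), (6, 20, 31, 1, 0), (6, 20, 33, 0, 1),
   (6, 21, 22, 0, 0), (6, 21, 27, 1, 1), (6, 23, 28, 1, 0), (6, 25, 33, 1, 0), (6, 26, 30, 0, 1),
   (6, 26, 34, 1, 1), (6, 28, 34, 1, 0), (9, 11, 29, 0, 0), (9, 11, 32, 1, 1), (9, 14, 20, 1, 1),
   (9, 14, 30, 0, 1), (9, 17, 24, 1, 1), (9, 17, 34, 0, 0), (9, 20, 28, 0, 1), (9, 23, 28, 0, 0),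
   (10, 11, 21, 0, 1), (10, 11, 33, 1, 0), (10, 14, 17, 1, 0), (10, 14, 30, 0, 0),
   (10, 17, 27, 1, 1), (10, 20, 25, 0, 1), (10, 23, 27, 0, 0), (10, 29, 32, 1, 1),
   (11, 14, 27, 0, 0), (11, 14, 31, 1, 1), (11, 15, 26, 0, 1), (11, 16, 24, 0, 0),
   (11, 17, 28, 0, 1), (11, 19, 30, 1, 1), (11, 20, 26, 1, 0), (11, 20, 32, 0, 1),
   (11, 22, 25, 1, 0), (11, 22, 34, 0, 0), (11, 24, 27, 1, 1), (11, 28, 31, 0, 0),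
   (14, 15, 33, 0, 1), (14, 18, 21, 1, 0), (14, 18, 34, 0, 1), (14, 19, 26, 1, 0),
   (14, 22, 25, 1, 1), (14, 22, 32, 0, 0), (14, 23, 29, 1, 0), (17, 18, 32, 0, 1),
   (17, 20, 28, 0, 0), (17, 21, 30, 0, 1), (17, 22, 26, 1, 0), (17, 22, 29, 0, 0),
   (17, 25, 32, 0, 0), (20, 24, 25, 0, 0), (23, 24, 33, 1, 1), (23, 30, 31, 0, 1),
   (23, 30, 32, 1, 1), (26, 27, 29, 1, 1), (29, 33, 34, 0, 1)]

/-- Triples fixed by `rotateColumn`. -/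
def shortOrbits35 : List (ℕ × ℕ × ℕ × ℕ × ℕ) :=
  [(26, 27, 28, 0, 0), (29, 30, 31, 0, 0), (32, 33, 34, 0, 0)]

set_option maxRecDepth 4000 in
theorem packs_triples35 :
    Packs {a : ℕ × ℕ × ZMod 2 | (offHole 11 35 a.1 a.2.1 && a.1 != a.2.1) = true} 360 :=
  Packs.of_check (P := fun c d _ => offHole 11 35 c d && c != d)
    (l := shortOrbits35 ++ longOrbits35.flatMap fun t =>
      let r := rotateColumn
      [t, (r t.1, r t.2.1, r t.2.2.1, t.2.2.2),
        (r (r t.1), r (r t.2.1), r (r t.2.2.1), t.2.2.2)])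
    (by decide +kernel)

/-- Triples over `ℤ/22` on three columns with all differences nonzero modulo `11`. -/
def triplesThree : List (ℕ × ℕ × ℕ × ℕ × ℕ) :=
  [(0, 1, 2, 1, 21), (0, 1, 2, 2, 3), (0, 1, 2, 3, 16), (0, 1, 2, 4, 8), (0, 1, 2, 5, 10),
   (0, 1, 2, 6, 20), (0, 1, 2, 7, 15), (0, 1, 2, 8, 18), (0, 1, 2, 9, 6), (0, 1, 2, 10, 19),
   (0, 1, 2, 12, 14), (0, 1, 2, 13, 7), (0, 1, 2, 14, 9), (0, 1, 2, 15, 5), (0, 1, 2, 16, 1),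
   (0, 1, 2, 17, 13), (0, 1, 2, 18, 17), (0, 1, 2, 19, 12), (0, 1, 2, 20, 4), (0, 1, 2, 21, 2)]

theorem packs_triplesThree :
    Packs {a : ℕ × ℕ × ZMod 22 |
      (offHole 0 3 a.1 a.2.1 && a.1 != a.2.1 && a.2.2.val % 11 != 0) = true} 20 :=
  Packs.of_check (P := fun c d x => offHole 0 3 c d && c != d && x % 11 != 0) (l := triplesThree)
    (by decide +kernel)

/-- The orbits of triples over `ℤ/22` under multiplication by `3`. -/
def multiplierOrbits (l : List (ℕ × ℕ × ℕ × ℕ × ℕ)) : List (ℕ × ℕ × ℕ × ℕ × ℕ) :=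
  l.flatMap fun t => [1, 3, 9, 5, 15].map fun m =>
    (t.1, t.2.1, t.2.2.1, m * t.2.2.2.1, m * t.2.2.2.2)

/-- Triples over `ℤ/22` on `5` columns, up to multiplication by `3`. -/
def orbits5 : List (ℕ × ℕ × ℕ × ℕ × ℕ) :=
  [(0, 1, 1, 12, 13), (0, 1, 2, 1, 4), (0, 1, 2, 2, 8), (0, 2, 2, 1, 13), (0, 3, 3, 1, 13),
   (0, 3, 4, 2, 8), (0, 3, 4, 12, 3), (0, 4, 4, 12, 13), (1, 1, 3, 12, 13), (1, 2, 3, 13, 8),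
   (1, 2, 4, 12, 3), (1, 3, 4, 12, 13), (1, 4, 4, 12, 2), (2, 2, 4, 1, 4), (2, 3, 3, 1, 2),
   (2, 3, 4, 12, 2)]

theorem packs_orbits5 :
    Packs {a : ℕ × ℕ × ZMod 22 |
      (offHole 1 5 a.1 a.2.1 && a.2.2.val % 11 != 0) = true} 80 :=
  Packs.of_check (P := fun c d x => offHole 1 5 c d && x % 11 != 0) (l := multiplierOrbits orbits5)
    (by decide +kernel)

/-- Triples over `ℤ/22` on `7` columns, up to multiplication by `3`. -/
def orbits7 : List (ℕ × ℕ × ℕ × ℕ × ℕ) :=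
  [(0, 1, 2, 1, 13), (0, 1, 3, 2, 3), (0, 1, 4, 12, 15), (0, 1, 4, 13, 8), (0, 2, 2, 1, 2),
   (0, 2, 3, 12, 4), (0, 3, 4, 2, 19), (0, 3, 4, 13, 14), (0, 5, 5, 1, 13), (0, 5, 6, 2, 8),
   (0, 5, 6, 12, 3), (0, 6, 6, 12, 13), (1, 1, 2, 12, 13), (1, 1, 3, 1, 13), (1, 2, 3, 2, 8),
   (1, 4, 4, 12, 2), (1, 5, 5, 2, 17), (1, 5, 6, 1, 15), (1, 5, 6, 12, 13), (1, 6, 6, 12, 2),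
   (2, 2, 5, 12, 2), (2, 3, 5, 13, 1), (2, 3, 6, 1, 18), (2, 4, 5, 2, 19), (2, 4, 6, 1, 7),
   (2, 4, 6, 12, 3), (2, 4, 6, 13, 14), (3, 3, 5, 12, 13), (3, 3, 6, 1, 4), (3, 4, 5, 2, 12),
   (3, 4, 6, 12, 2), (4, 4, 5, 1, 4)]

theorem packs_orbits7 :
    Packs {a : ℕ × ℕ × ZMod 22 |
      (offHole 1 7 a.1 a.2.1 && a.2.2.val % 11 != 0) = true} 160 :=
  Packs.of_check (P := fun c d x => offHole 1 7 c d && x % 11 != 0) (l := multiplierOrbits orbits7)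
    (by decide +kernel)

/-- Triples over `ℤ/22` on `11` columns, up to multiplication by `3`. -/
def orbits11 : List (ℕ × ℕ × ℕ × ℕ × ℕ) :=
  [(0, 5, 6, 1, 14), (0, 5, 6, 2, 6), (0, 5, 6, 12, 15), (0, 5, 7, 13, 19), (0, 6, 7, 13, 12),
   (0, 7, 8, 2, 1), (0, 7, 9, 1, 14), (0, 8, 8, 12, 2), (0, 8, 10, 13, 19), (0, 9, 9, 1, 13),
   (0, 9, 10, 2, 1), (0, 10, 10, 12, 2), (1, 5, 8, 2, 12), (1, 5, 9, 12, 3), (1, 5, 10, 1, 18),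
   (1, 5, 10, 13, 14), (1, 6, 7, 13, 19), (1, 6, 9, 1, 13), (1, 6, 9, 2, 8), (1, 6, 10, 12, 7),
   (1, 7, 8, 2, 3), (1, 7, 9, 12, 4), (1, 7, 10, 1, 3), (1, 8, 8, 2, 17), (2, 5, 5, 12, 2),
   (2, 5, 9, 1, 15), (2, 5, 10, 13, 3), (2, 6, 7, 13, 6), (2, 6, 8, 1, 13), (2, 6, 8, 12, 3),
   (2, 6, 10, 2, 6), (2, 7, 7, 1, 13), (2, 7, 9, 12, 18), (2, 8, 9, 2, 14), (2, 8, 10, 12, 4),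
   (2, 9, 10, 13, 17), (3, 5, 8, 2, 6), (3, 5, 8, 12, 3), (3, 5, 9, 1, 3), (3, 5, 9, 13, 14),
   (3, 6, 6, 1, 2), (3, 6, 7, 12, 2), (3, 6, 10, 13, 1), (3, 7, 9, 12, 13), (3, 7, 10, 1, 2),
   (3, 7, 10, 13, 12), (3, 8, 9, 13, 6), (3, 8, 10, 12, 7), (4, 5, 5, 12, 3), (4, 5, 6, 2, 8),
   (4, 5, 7, 13, 6), (4, 6, 6, 1, 13), (4, 6, 8, 12, 13), (4, 7, 8, 12, 2), (4, 7, 8, 13, 1),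
   (4, 7, 10, 1, 13), (4, 8, 9, 12, 14), (4, 9, 9, 1, 2), (4, 9, 10, 13, 6), (4, 10, 10, 12, 3),
   (5, 7, 7, 12, 13), (5, 8, 10, 1, 2), (6, 8, 9, 2, 1), (6, 9, 10, 13, 1)]

set_option maxRecDepth 4000 in
theorem packs_orbits11 :
    Packs {a : ℕ × ℕ × ZMod 22 |
      (offHole 5 11 a.1 a.2.1 && a.2.2.val % 11 != 0) = true} 320 :=
  Packs.of_check (P := fun c d x => offHole 5 11 c d && x % 11 != 0) (l := multiplierOrbits orbits11)
    (by decide +kernel)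

namespace Packs

/-- Replacing every triple of plain columns by the four triples over two copies of the columns
whose labels have sum zero. -/
theorem double {C : Type} {B : Set (C × C × Unit)} {n : ℕ} (hB : Packs B n) :
    Packs {a : (C × ZMod 2) × (C × ZMod 2) × Unit | (a.1.1, a.2.1.1, ()) ∈ B} (4 * n) := by
  obtain ⟨ι, _, f, rfl, h1, h2⟩ := hB
  refine ⟨(ZMod 2 × ZMod 2) × ι, inferInstance,
    fun b i => (((f b.2 i).1, ![b.1.1, b.1.2, b.1.1 + b.1.2] i), ()), by simp,
    fun b i j hij => h1 b.2 i j hij, ?_⟩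
  rintro ⟨a, b⟩ ⟨a', b'⟩ i i' j j' hij hij' he
  simp only [arrow, Prod.mk.injEq] at he
  obtain ⟨⟨e1, e2⟩, ⟨e3, e4⟩, -⟩ := he
  obtain ⟨rfl, rfl, rfl⟩ := h2 b b' i i' j j' hij hij' (by simp [arrow, e1, e3])
  refine ⟨?_, rfl, rfl⟩
  have key : ∀ (a a' : ZMod 2 × ZMod 2) (i j : Fin 3), i ≠ j →
      ![a.1, a.2, a.1 + a.2] i = ![a'.1, a'.2, a'.1 + a'.2] i →
      ![a.1, a.2, a.1 + a.2] j = ![a'.1, a'.2, a'.1 + a'.2] j → a = a' := by decide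
  rw [key a a' i j hij e2 e4]

/-- Doubling the columns of a packing in which every column occurs once in each position leaves
room for three further pairs of columns. -/
theorem double_adjoin {C ι : Type} [Fintype ι] (f : ι → Fin 3 → C)
    (hpos : ∀ i, Function.Injective fun b => f b i)
    (h : ∀ b b' i i' j j', i ≠ j → i' ≠ j' → f b i = f b' i' → f b j = f b' j' →
      b = b' ∧ i = i' ∧ j = j') :
    Packs {a : ((C ⊕ Fin 3) × ZMod 2) × ((C ⊕ Fin 3) × ZMod 2) × Unit |
      (a.1.1.isLeft ∨ a.2.1.1.isLeft) ∧ ∀ c d, a.1.1 = Sum.inl c → a.2.1.1 = Sum.inl d →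
        ∃ b i j, i ≠ j ∧ f b i = c ∧ f b j = d} (8 * Fintype.card ι) := by
  let label : Option (Fin 3) × ZMod 2 → Fin 3 → ZMod 2 := fun a i =>
    if a.1 = some (i + 1) then a.2 + 1 else a.2
  have hlabel : ∀ (a a' : Option (Fin 3) × ZMod 2) (i j : Fin 3), i ≠ j → a.1 ≠ some i →
      a.1 ≠ some j → a'.1 ≠ some i → a'.1 ≠ some j → label a i = label a' i →
      label a j = label a' j → a = a' := by decide
  have hlabel' : ∀ (a : ZMod 2) (i j j' : Fin 3), i ≠ j → i ≠ j' →
      label (some i, a) j = label (some i, a) j' → j = j' := by decide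
  let pt : (Option (Fin 3) × ZMod 2) × ι → Fin 3 → (C ⊕ Fin 3) × ZMod 2 := fun b i =>
    if b.1.1 = some i then (Sum.inr i, b.1.2) else (Sum.inl (f b.2 i), label b.1 i)
  have hr : ∀ a b i, pt ((some i, a), b) i = (Sum.inr i, a) := fun a b i => if_pos rfl
  have hl : ∀ a b i, a.1 ≠ some i → pt (a, b) i = (Sum.inl (f b i), label a i) :=
    fun a b i hi => if_neg hi
  have hmeet : ∀ a b b' a' i i' j j', i ≠ j → i' ≠ j' → pt ((some i, a), b) i = pt (a', b') i' →
      pt ((some i, a), b) j = pt (a', b') j' →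
      ((some i, a), b) = (a', b') ∧ i = i' ∧ j = j' := by
    intro a b b' a' i i' j j' hij hij' e1 e2
    by_cases hi' : a'.1 = some i'
    · obtain ⟨κ, a'⟩ := a'
      obtain rfl : κ = some i' := hi'
      rw [hr, hr] at e1
      simp only [Prod.mk.injEq, Sum.inr.injEq] at e1
      obtain ⟨rfl, rfl⟩ := e1
      rw [hl _ _ _ (by simpa using hij), hl _ _ _ (by simpa using hij')] at e2
      simp only [Prod.mk.injEq, Sum.inl.injEq] at e2
      obtain rfl := hlabel' a i j j' hij hij' e2.2
      exact ⟨by rw [hpos j e2.1], rfl, rfl⟩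
    · rw [hr, hl _ _ _ hi'] at e1
      simp at e1
  refine ⟨(Option (Fin 3) × ZMod 2) × ι, inferInstance, fun b i => (pt b i, ()),
    by simp [ZMod.card], ?_, ?_⟩
  · rintro ⟨a, b⟩ i j hij
    by_cases hi : a.1 = some i <;> by_cases hj : a.1 = some j
    · exact absurd (Option.some.inj (hi.symm.trans hj)) hij
    all_goals simp [arrow, pt, hi, hj]
    · simp [hij]
    · simp [hij.symm]
    · exact ⟨b, i, j, hij, rfl, rfl⟩
  · rintro ⟨a, b⟩ ⟨a', b'⟩ i i' j j' hij hij' he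
    simp only [arrow, Prod.mk.injEq] at he
    obtain ⟨e1, e2, -⟩ := he
    by_cases hi : a.1 = some i
    · obtain ⟨κ, a⟩ := a
      obtain rfl : κ = some i := hi
      exact hmeet _ _ _ _ _ _ _ _ hij hij' e1 e2
    by_cases hj : a.1 = some j
    · obtain ⟨κ, a⟩ := a
      obtain rfl : κ = some j := hj
      obtain ⟨h1, h2, h3⟩ := hmeet _ _ _ _ _ _ _ _ hij.symm hij'.symm e2 e1
      exact ⟨h1, h3, h2⟩
    by_cases hi' : a'.1 = some i'
    · obtain ⟨κ, a'⟩ := a'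
      obtain rfl : κ = some i' := hi'
      obtain ⟨h1, h2, h3⟩ := hmeet _ _ _ _ _ _ _ _ hij' hij e1.symm e2.symm
      exact ⟨h1.symm, h2.symm, h3.symm⟩
    by_cases hj' : a'.1 = some j'
    · obtain ⟨κ, a'⟩ := a'
      obtain rfl : κ = some j' := hj'
      obtain ⟨h1, h2, h3⟩ := hmeet _ _ _ _ _ _ _ _ hij'.symm hij.symm e2.symm e1.symm
      exact ⟨h1.symm, h3.symm, h2.symm⟩
    rw [hl _ _ _ hi, hl _ _ _ hi'] at e1
    rw [hl _ _ _ hj, hl _ _ _ hj'] at e2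
    simp only [Prod.mk.injEq, Sum.inl.injEq] at e1 e2
    obtain ⟨rfl, rfl, rfl⟩ := h b b' i i' j j' hij hij' e1.1 e2.1
    exact ⟨by rw [hlabel a a' i j hij hi hj hi' hj' e1.2 e2.2], rfl, rfl⟩

end Packs

/-- The triples `(z - d, i), (z + d, i), (z, i + 1)` over a cyclic group of odd order. -/
def boseTriple {A : Type} [AddCommGroup A] (d : A) (b : A × Fin 3) : Fin 3 → A × Fin 3 :=
  ![(b.1 - d, b.2), (b.1 + d, b.2), (b.1, b.2 + 1)]

theorem boseTriple_position_injective {A : Type} [AddCommGroup A] (d : A) (i : Fin 3) :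
    Function.Injective fun b => boseTriple d b i := by
  rintro ⟨z, k⟩ ⟨z', k'⟩ h
  fin_cases i <;> simpa [boseTriple] using h

theorem boseTriple_injective {A : Type} [AddCommGroup A] (hA : ∀ x : A, x + x = 0 → x = 0)
    {d d' : A} (hd : d + d' ≠ 0) {b b' : A × Fin 3} {i i' j j' : Fin 3} (hij : i ≠ j)
    (hij' : i' ≠ j') (hi : boseTriple d b i = boseTriple d' b' i')
    (hj : boseTriple d b j = boseTriple d' b' j') : d = d' ∧ b = b' ∧ i = i' ∧ j = j' := by
  obtain ⟨z, k⟩ := b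
  obtain ⟨z', k'⟩ := b'
  have hsub : d + d = d' + d' → d = d' := fun h =>
    sub_eq_zero.1 (hA _ (by rw [sub_add_sub_comm, h, sub_self]))
  have hadd := hA (d + d')
  have hz : z + d = z' + d' → d = d' → z = z' := fun h h' => by
    rwa [h', add_left_inj] at h
  have hF : ∀ k k' : Fin 3, k = k' + 1 → k + 1 = k' → False := by decide
  have hF0 : ∀ k : Fin 3, k + 1 ≠ k := by decide
  fin_cases i <;> fin_cases j <;> fin_cases i' <;> fin_cases j' <;>
    simp [boseTriple] at hij hij' hi hj ⊢ <;> grind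

theorem boseTriple_fst_ne {A : Type} [AddCommGroup A] (hA : ∀ x : A, x + x = 0 → x = 0) {d : A}
    (hd : d ≠ 0) (b : A × Fin 3) {i j : Fin 3} (hij : i ≠ j) :
    (boseTriple d b i).1 ≠ (boseTriple d b j).1 := by
  have h1 : b.1 - d ≠ b.1 + d := fun h => hd (hA d (by
    rw [sub_eq_iff_eq_add, add_assoc] at h
    simpa using h))
  have h2 : b.1 ≠ b.1 - d := fun h => hd (sub_eq_self.1 h.symm)
  fin_cases i <;> fin_cases j <;> simp [boseTriple, hd, h1, h1.symm, h2] at hij ⊢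

theorem Packs.bose {A κ : Type} [AddCommGroup A] [Fintype A] [Fintype κ]
    (hA : ∀ x : A, x + x = 0 → x = 0) (h : κ → A) (hinj : h.Injective)
    (hadd : ∀ k k', h k + h k' ≠ 0) :
    Packs {a : (A × Fin 3) × (A × Fin 3) × Unit | ∃ k b i j, i ≠ j ∧
      boseTriple (h k) b i = a.1 ∧ boseTriple (h k) b j = a.2.1}
      (Fintype.card κ * (Fintype.card A * 3)) := by
  refine ⟨κ × A × Fin 3, inferInstance, fun b i => (boseTriple (h b.1) b.2 i, ()), by simp,
    fun b i j hij => ⟨b.1, b.2, i, j, hij, rfl, rfl⟩, fun b b' i i' j j' hij hij' he => ?_⟩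
  simp only [arrow, Prod.mk.injEq] at he
  obtain ⟨h1, h2, h3⟩ := boseTriple_injective hA (hadd _ _) hij hij' he.1 he.2.1
  exact ⟨Prod.ext (hinj h1) h2, h3⟩

theorem Packs.sixfold_zmod (t : ℕ) :
    Packs {a : (ZMod (2 * t + 1) × Fin 3 × ZMod 2) × (ZMod (2 * t + 1) × Fin 3 × ZMod 2) × Unit |
      a.1.1 ≠ a.2.1.1} (6 * (2 * t + 1) * (2 * t)) ∧
    (t ≠ 0 → Packs {a : (Option (ZMod (2 * t + 1)) × Fin 3 × ZMod 2) ×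
      (Option (ZMod (2 * t + 1)) × Fin 3 × ZMod 2) × Unit | a.1.1 ≠ a.2.1.1}
      (6 * (2 * t + 2) * (2 * t + 1))) := by
  set A := ZMod (2 * t + 1) with hAdef
  have hcard : Fintype.card A = 2 * t + 1 := ZMod.card _
  have hA : ∀ x : A, x + x = 0 → x = 0 := fun x hx => by
    have h2 : IsUnit ((2 : ℕ) : A) :=
      (ZMod.isUnit_iff_coprime 2 (2 * t + 1)).2 (by simp)
    rw [← two_mul] at hx
    exact (h2.mul_right_eq_zero).1 (by exact_mod_cast hx)
  let h : ℕ → A := fun k => ((k + 1 : ℕ) : A)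
  have hzero : ∀ k, 0 < k → k < 2 * t + 1 → ((k : ℕ) : A) ≠ 0 := fun k h1 h2 h3 => by
    rw [ZMod.natCast_eq_zero_iff] at h3
    exact absurd (Nat.le_of_dvd h1 h3) (by omega)
  have hadd : ∀ k k', k < t → k' < t → h k + h k' ≠ 0 := fun k k' hk hk' => by
    simp only [h]
    rw [← Nat.cast_add]
    exact hzero _ (by omega) (by omega)
  have hinj : ∀ k k', k < t → k' < t → h k = h k' → k = k' := fun k k' hk hk' he => by
    rw [ZMod.natCast_eq_natCast_iff', Nat.mod_eq_of_lt (by omega), Nat.mod_eq_of_lt (by omega)]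
      at he
    omega
  have hne : ∀ k, k < t → h k ≠ 0 := fun k hk => hzero _ (by omega) (by omega)
  constructor
  · have hB := (Packs.bose (κ := Fin t) hA (fun k => h k)
      (fun k k' he => Fin.ext (hinj _ _ k.2 k'.2 he)) (fun k k' => hadd _ _ k.2 k'.2)).double
    rw [hcard, Fintype.card_fin, show 4 * (t * ((2 * t + 1) * 3)) = 6 * (2 * t + 1) * (2 * t) by
      ring] at hB
    refine hB.map_injective (φ := fun c => (c.1.1, c.1.2, c.2)) (ψ := AddMonoidHom.id _)
      (fun c d hcd => ?_) Function.injective_id ?_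
    · simp only [Prod.mk.injEq] at hcd
      exact Prod.ext (Prod.ext hcd.1 hcd.2.1) hcd.2.2
    · rintro c d x ⟨k, b, i, j, hij, e1, e2⟩
      simp only [Set.mem_ofPred_eq] at e1 e2 ⊢
      rw [← e1, ← e2]
      exact boseTriple_fst_ne hA (hne k k.2) b hij
  · intro ht
    let φ : (A × Fin 3 ⊕ Fin 3) × ZMod 2 → Option A × Fin 3 × ZMod 2 := fun c =>
      (c.1.elim (fun x => some x.1) (fun _ => none), c.1.elim (fun x => x.2) id, c.2)
    have hφ : φ.Injective := by
      rintro ⟨c | c, a⟩ ⟨d | d, b⟩ hcd <;> simp [φ] at hcd ⊢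
      · exact ⟨Prod.ext hcd.1 hcd.2.1, hcd.2.2⟩
      · exact hcd
    have h0 := Packs.double_adjoin (boseTriple (h 0)) (boseTriple_position_injective _)
      (fun b b' i i' j j' hij hij' e1 e2 => (boseTriple_injective hA
        (hadd 0 0 (by omega) (by omega)) hij hij' e1 e2).2)
    have hB := ((Packs.bose (κ := Fin (t - 1)) hA (fun k => h (k + 1))
      (fun k k' he => Fin.ext (by have := hinj _ _ (by omega) (by omega) he; omega))
      (fun k k' => hadd _ _ (by omega) (by omega))).double).map_injective
        (φ := fun c => ((Sum.inl c.1 : A × Fin 3 ⊕ Fin 3), c.2)) (ψ := AddMonoidHom.id _)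
        (E' := {a | ∃ (k : Fin (t - 1)) (b : A × Fin 3) (i j : Fin 3), i ≠ j ∧
          a.1.1 = Sum.inl (boseTriple (h (k + 1)) b i) ∧
          a.2.1.1 = Sum.inl (boseTriple (h (k + 1)) b j)})
        (fun c d hcd => by
          simp only [Prod.mk.injEq, Sum.inl.injEq] at hcd
          exact Prod.ext hcd.1 hcd.2)
        Function.injective_id (by
          rintro c d x ⟨k, b, i, j, hij, e1, e2⟩
          exact ⟨k, b, i, j, hij, congrArg _ e1.symm, congrArg _ e2.symm⟩)
    have hU := h0.union hB (by
      rintro ⟨⟨c, a⟩, ⟨d, a'⟩, x⟩ ⟨-, h1⟩ ⟨k, b, i, j, hij, rfl, rfl⟩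
      obtain ⟨b', i', j', hij', e1, e2⟩ := h1 _ _ rfl rfl
      have := hinj _ _ (by omega) (by omega) (boseTriple_injective hA
        (hadd 0 (k + 1) (by omega) (by omega)) hij' hij e1 e2).1
      omega)
    have hn : 8 * Fintype.card (A × Fin 3) +
        4 * (Fintype.card (Fin (t - 1)) * (Fintype.card A * 3)) =
        6 * (2 * t + 2) * (2 * t + 1) := by
      obtain ⟨t, rfl⟩ := Nat.exists_eq_succ_of_ne_zero ht
      simp only [Fintype.card_prod, hcard, Fintype.card_fin, Nat.succ_eq_add_one,
        Nat.add_sub_cancel]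
      ring
    rw [hn] at hU
    refine hU.map_injective hφ (ψ := AddMonoidHom.id _) Function.injective_id ?_
    rintro ⟨c, a⟩ ⟨d, a'⟩ x (⟨h1, h2⟩ | ⟨k, b, i, j, hij, e1, e2⟩)
    · rcases c with c | c <;> rcases d with d | d <;> simp [φ] at h1 ⊢
      obtain ⟨b, i, j, hij, rfl, rfl⟩ := h2 _ _ rfl rfl
      exact boseTriple_fst_ne hA (hne 0 (by omega)) b hij
    · simp only at e1 e2
      subst e1 e2
      simpa [φ] using boseTriple_fst_ne hA (hne (k + 1) (by omega)) b hij

theorem Packs.sixfold {X : Type} [Fintype X] (hX : Fintype.card X ≠ 2) :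
    Packs {a : (X × Fin 3 × ZMod 2) × (X × Fin 3 × ZMod 2) × Unit | a.1.1 ≠ a.2.1.1}
      (6 * Fintype.card X * (Fintype.card X - 1)) := by
  have transport : ∀ {Y : Type} [Fintype Y] {n : ℕ}, Fintype.card Y = Fintype.card X →
      Packs {a : (Y × Fin 3 × ZMod 2) × (Y × Fin 3 × ZMod 2) × Unit | a.1.1 ≠ a.2.1.1} n →
      Packs {a : (X × Fin 3 × ZMod 2) × (X × Fin 3 × ZMod 2) × Unit | a.1.1 ≠ a.2.1.1} n := by
    intro Y _ n hc hY
    let e := Fintype.equivOfCardEq hc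
    refine hY.map_injective (φ := fun c => (e c.1, c.2)) (ψ := AddMonoidHom.id _)
      (fun c d hcd => ?_) Function.injective_id (fun c d x h => ?_)
    · simp only [Prod.mk.injEq, e.injective.eq_iff] at hcd
      exact Prod.ext hcd.1 hcd.2
    · simpa using h
  rcases Nat.even_or_odd' (Fintype.card X) with ⟨t, ht | ht⟩
  · rcases t with _ | _ | t
    · rw [ht]
      exact Packs.of_isEmpty.mono (Set.empty_subset _)
    · exact absurd ht hX
    · have := (Packs.sixfold_zmod (t + 1)).2 (by omega)
      rw [ht]
      exact transport (by rw [Fintype.card_option, ZMod.card, ht]; ring) this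
  · rw [ht]
    exact transport (by rw [ZMod.card, ht]) (Packs.sixfold_zmod t).1

/-- Triples on three fixed columns with prescribed differences `x`, `y`, `x + y`. -/
theorem Packs.of_columns {C Γ ι : Type} [AddCommGroup Γ] [Fintype ι] {c₀ c₁ c₂ : C}
    (h01 : c₀ ≠ c₁) (h12 : c₁ ≠ c₂) (h02 : c₀ ≠ c₂) {x y z : ι → Γ} (hz : ∀ b, x b + y b = z b)
    (hxi : x.Injective) (hyi : y.Injective) (hzi : z.Injective) :
    Packs {a | ∃ b, a = (c₀, c₁, x b) ∨ a = (c₁, c₀, -x b) ∨ a = (c₁, c₂, y b) ∨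
      a = (c₂, c₁, -y b) ∨ a = (c₀, c₂, z b) ∨ a = (c₂, c₀, -z b)} (Fintype.card ι) := by
  refine ⟨ι, inferInstance, fun b => ![(c₀, 0), (c₁, x b), (c₂, z b)], rfl,
    fun b i j hij => ⟨b, ?_⟩, fun b b' i i' j j' hij hij' he => ?_⟩
  · have := hz b
    fin_cases i <;> fin_cases j <;> simp [arrow, ← this] at hij ⊢
  · have hy : ∀ b b', z b - x b = z b' - x b' → b = b' := fun b b' h => hyi (by
      rwa [← hz b, ← hz b', add_sub_cancel_left, add_sub_cancel_left] at h)
    have hy' : ∀ b b', x b - z b = x b' - z b' → b = b' := fun b b' h => hy b b' (by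
      rw [← neg_sub, h, neg_sub])
    fin_cases i <;> fin_cases j <;> fin_cases i' <;> fin_cases j' <;>
      simp [arrow, h01, h12, h02, h01.symm, h12.symm, h02.symm] at hij hij' he ⊢ <;>
      first
        | exact hxi he
        | exact hzi he
        | exact hy _ _ he
        | exact hy' _ _ he

theorem Packs.of_permutations {Γ ι : Type} [AddCommGroup Γ] [Fintype ι] {W : Set Γ}
    (hW : ∀ g ∈ W, -g ∈ W) {x y z : ι → Γ} (hz : ∀ b, x b + y b = z b)
    (hxi : x.Injective) (hyi : y.Injective) (hzi : z.Injective)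
    (hx : ∀ b, x b ∈ W) (hy : ∀ b, y b ∈ W) (hzW : ∀ b, z b ∈ W) :
    Packs {a : Fin 3 × Fin 3 × Γ | a.1 ≠ a.2.1 ∧ a.2.2 ∈ W} (Fintype.card ι) := by
  refine (Packs.of_columns (c₀ := 0) (c₁ := 1) (c₂ := 2) (by decide) (by decide) (by decide)
    hz hxi hyi hzi).mono ?_
  rintro _ ⟨b, rfl | rfl | rfl | rfl | rfl | rfl⟩
  exacts [⟨by simp, hx b⟩, ⟨by simp, hW _ (hx b)⟩, ⟨by simp, hy b⟩,
    ⟨by simp, hW _ (hy b)⟩, ⟨by simp, hzW b⟩, ⟨by simp, hW _ (hzW b)⟩]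

theorem packs_three_klein :
    Packs {a : Fin 3 × Fin 3 × (ZMod 2 × ZMod 2) | a.1 ≠ a.2.1 ∧ a.2.2 ∈ Set.univ} 4 :=
  Packs.of_permutations (ι := ZMod 2 × ZMod 2) (x := id) (y := fun a => (a.1 + a.2, a.1))
    (z := fun a => (a.2, a.1 + a.2)) (fun _ _ => trivial) (by decide) (by decide) (by decide)
    (by decide) (fun _ => trivial) (fun _ => trivial) (fun _ => trivial)

theorem packs_three_nonzero {A : Type} [AddCommGroup A] [Fintype A]
    (h2 : ∀ x : A, 2 • x = 0 → x = 0) (h3 : ∀ x : A, 3 • x = 0 → x = 0) (γ : A → ZMod 2)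
    (hγ : ∀ x, x ≠ 0 → γ (-x) = γ x + 1) :
    Packs {a : Fin 3 × Fin 3 × (ZMod 2 × A) | a.1 ≠ a.2.1 ∧ a.2.2 ∈ {g | g.2 ≠ 0}}
      (2 * (Fintype.card A - 1)) := by
  classical
  have hinj : ∀ n : ℕ, (∀ x : A, n • x = 0 → x = 0) → ∀ x y : A, n • x = n • y → x = y :=
    fun n hn x y h => sub_eq_zero.1 (hn _ (by rw [smul_sub, h, sub_self]))
  have h01 : (0 : ZMod 2) ≠ 1 := by decide
  have hs : ∀ a : ZMod 2, a ≠ a + 1 := by decide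
  have key := Packs.of_permutations (ι := Bool × {t : A // t ≠ 0})
    (W := {g : ZMod 2 × A | g.2 ≠ 0}) (fun g hg => neg_ne_zero.2 hg)
    (x := fun b => if b.1 then (1, b.2.1) else (0, 3 • b.2.1))
    (y := fun b => if b.1 then (γ b.2, b.2.1) else (γ b.2, -b.2.1))
    (z := fun b => if b.1 then (γ b.2 + 1, 2 • b.2.1) else (γ b.2, 2 • b.2.1))
    ?_ ?_ ?_ ?_ ?_ ?_ ?_
  · simpa [Fintype.card_subtype_compl] using! key
  · rintro ⟨_ | _, t, ht⟩ <;> simp [add_comm]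
    · abel
    · rw [two_nsmul]
  · rintro ⟨_ | _, t, ht⟩ ⟨_ | _, t', ht'⟩ h <;> simp [h01, h01.symm] at h ⊢
    · exact hinj 3 h3 _ _ h
    · exact h
  · rintro ⟨_ | _, t, ht⟩ ⟨_ | _, t', ht'⟩ h <;> simp at h ⊢
    · exact h.2
    · obtain ⟨h, rfl⟩ := h
      rw [hγ t ht] at h
      exact hs _ h
    · obtain ⟨h, rfl⟩ := h
      rw [hγ t' ht'] at h
      exact hs _ h.symm
    · exact h.2
  · rintro ⟨_ | _, t, ht⟩ ⟨_ | _, t', ht'⟩ h <;> simp at h ⊢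
    · exact hinj 2 h2 _ _ h.2
    · rw [hinj 2 h2 _ _ h.2] at h
      exact hs _ h.1
    · rw [hinj 2 h2 _ _ h.2] at h
      exact hs _ h.1.symm
    · exact hinj 2 h2 _ _ h.2
  · rintro ⟨_ | _, t, ht⟩
    · exact fun h => ht (h3 _ h)
    · exact ht
  · rintro ⟨_ | _, t, ht⟩
    · exact neg_ne_zero.2 ht
    · exact ht
  · rintro ⟨_ | _, t, ht⟩
    · exact fun h => ht (h2 _ h)
    · exact fun h => ht (h2 _ h)

/-- The differences `lo, lo + 1, …, lo + len - 1` from column `c` to column `d`, and back. -/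
def arc {N : ℕ} (c d : ℕ) (lo : ZMod N) (len : ℕ) : Set (ℕ × ℕ × ZMod N) :=
  {a | ∃ i < len, a = (c, d, lo + i) ∨ a = (d, c, -(lo + i))}

/-- A permutation `σ` of `{0, …, 2q - 1}` such that `σ i - i` takes every value from `-q` to `q`
except one. -/
def skewReversal (q i : ℕ) : ℕ := if i < q then 2 * i + 1 else 2 * i - 2 * q

/-- The value `q + i - skewReversal q i`, which takes every value in `{0, …, 2q}` except `q`. -/
def skewSum (q i : ℕ) : ℕ := if i < q then q - 1 - i else 3 * q - i

theorem natCast_injOn_of_le {N p : ℕ} (h : p ≤ N) {i j : ℕ} (hi : i < p) (hj : j < p)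
    (he : (i : ZMod N) = j) : i = j := by
  rwa [ZMod.natCast_eq_natCast_iff', Nat.mod_eq_of_lt (by omega), Nat.mod_eq_of_lt (by omega)]
    at he

/-- The hole in the middle of the range of differences lies on the first pair of columns. -/
theorem packs_arcs_first {N q c₀ c₁ c₂ : ℕ} (hN : 2 * q + 1 ≤ N) (h01 : c₀ ≠ c₁) (h12 : c₁ ≠ c₂)
    (h02 : c₀ ≠ c₂) {s s' t u : ZMod N} (hu : s + t + q = u) (hs' : s + q + 1 = s') :
    Packs (arc c₀ c₁ s q ∪ arc c₀ c₁ s' q ∪ arc c₁ c₂ t (2 * q) ∪ arc c₀ c₂ u (2 * q))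
      (2 * q) := by
  have hsum : ∀ i < 2 * q, skewSum q i + skewReversal q i = q + i := fun i hi => by
    unfold skewSum skewReversal; split_ifs <;> omega
  have key := Packs.of_columns (ι := Fin (2 * q)) h01 h12 h02
    (x := fun i => s + (skewSum q i : ℕ)) (y := fun i => t + (skewReversal q i : ℕ))
    (z := fun i => u + (i : ℕ)) (fun i => ?_) ?_ ?_ ?_
  · rw [Fintype.card_fin] at key
    refine key.mono ?_
    have hfirst : ∀ i < 2 * q, ∃ j < q, s + (skewSum q i : ZMod N) = s + j ∨
        s + (skewSum q i : ZMod N) = s' + j := fun i hi => by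
      by_cases h : i < q
      · exact ⟨skewSum q i, by unfold skewSum; rw [if_pos h]; omega, Or.inl rfl⟩
      · refine ⟨skewSum q i - (q + 1), by unfold skewSum; rw [if_neg h]; omega, Or.inr ?_⟩
        rw [← hs', Nat.cast_sub (by unfold skewSum; rw [if_neg h]; omega)]
        push_cast
        ring
    have hrev : ∀ i < 2 * q, skewReversal q i < 2 * q := fun i hi => by
      unfold skewReversal; split_ifs <;> omega
    rintro _ ⟨i, rfl | rfl | rfl | rfl | rfl | rfl⟩
    · obtain ⟨j, hj, h | h⟩ := hfirst i i.2
      · exact Or.inl (Or.inl (Or.inl ⟨j, hj, Or.inl (by rw [h])⟩))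
      · exact Or.inl (Or.inl (Or.inr ⟨j, hj, Or.inl (by rw [h])⟩))
    · obtain ⟨j, hj, h | h⟩ := hfirst i i.2
      · exact Or.inl (Or.inl (Or.inl ⟨j, hj, Or.inr (by rw [h])⟩))
      · exact Or.inl (Or.inl (Or.inr ⟨j, hj, Or.inr (by rw [h])⟩))
    · exact Or.inl (Or.inr ⟨_, hrev i i.2, Or.inl rfl⟩)
    · exact Or.inl (Or.inr ⟨_, hrev i i.2, Or.inr rfl⟩)
    · exact Or.inr ⟨i, i.2, Or.inl rfl⟩
    · exact Or.inr ⟨i, i.2, Or.inr rfl⟩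
  · have := congrArg (Nat.cast (R := ZMod N)) (hsum i i.2)
    push_cast at this
    rw [← hu]
    linear_combination this
  · intro i j h
    have := natCast_injOn_of_le hN (by unfold skewSum; split_ifs <;> omega)
      (by unfold skewSum; split_ifs <;> omega) (add_left_cancel h)
    unfold skewSum at this
    ext
    split_ifs at this <;> omega
  · intro i j h
    have := natCast_injOn_of_le hN (by unfold skewReversal; split_ifs <;> omega)
      (by unfold skewReversal; split_ifs <;> omega) (add_left_cancel h)
    unfold skewReversal at this
    ext
    split_ifs at this <;> omega
  · intro i j h
    exact Fin.ext (natCast_injOn_of_le hN (by omega) (by omega) (add_left_cancel h))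

/-- The hole in the middle of the range of differences lies on the second pair of columns. -/
theorem packs_arcs_second {N q c₀ c₁ c₂ : ℕ} (hN : 2 * q + 1 ≤ N) (h01 : c₀ ≠ c₁) (h12 : c₁ ≠ c₂)
    (h02 : c₀ ≠ c₂) {s s' t u : ZMod N} (hu : t + s + q = u) (hs' : s + q + 1 = s') :
    Packs (arc c₁ c₂ s q ∪ arc c₁ c₂ s' q ∪ arc c₀ c₁ t (2 * q) ∪ arc c₀ c₂ u (2 * q))
      (2 * q) := by
  have hrev : ∀ (c d : ℕ) (lo : ZMod N) (len : ℕ) (a : ℕ × ℕ × ZMod N),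
      a ∈ arc d c (-lo - ((len : ZMod N) - 1)) len ↔ a ∈ arc c d lo len := by
    intro c d lo len a
    constructor
    · rintro ⟨i, hi, h⟩
      refine ⟨len - 1 - i, by omega, ?_⟩
      rw [Nat.cast_sub (by omega), Nat.cast_sub (by omega)]
      rcases h with rfl | rfl
      · right; congr 2; ring
      · left; congr 2; ring
    · rintro ⟨i, hi, h⟩
      refine ⟨len - 1 - i, by omega, ?_⟩
      rw [Nat.cast_sub (by omega), Nat.cast_sub (by omega)]
      rcases h with rfl | rfl
      · right; congr 2; ring
      · left; congr 2; ring
  refine (packs_arcs_first (s := -s' - ((q : ZMod N) - 1))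
    (s' := -s - ((q : ZMod N) - 1)) (t := -t - (((2 * q : ℕ) : ZMod N) - 1))
    (u := -u - (((2 * q : ℕ) : ZMod N) - 1)) hN h12.symm h01.symm
    h02.symm ?_ ?_).mono ?_
  · rw [← hu, ← hs']; ring
  · rw [← hs']; ring
  · rintro a (((h | h) | h) | h) <;> rw [hrev] at h
    · exact Or.inl (Or.inl (Or.inr h))
    · exact Or.inl (Or.inl (Or.inl h))
    · exact Or.inl (Or.inr h)
    · exact Or.inr h

theorem packs_single {N c₀ c₁ c₂ : ℕ} (h01 : c₀ ≠ c₁) (h12 : c₁ ≠ c₂) (h02 : c₀ ≠ c₂)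
    {s t u : ZMod N} (hu : s + t = u) :
    Packs (arc c₀ c₁ s 1 ∪ arc c₁ c₂ t 1 ∪ arc c₀ c₂ u 1) 1 := by
  refine (Packs.of_columns (ι := Unit) h01 h12 h02 (x := fun _ => s) (y := fun _ => t)
    (z := fun _ => u) (fun _ => hu) (fun _ _ _ => rfl) (fun _ _ _ => rfl)
    (fun _ _ _ => rfl)).mono ?_
  rintro _ ⟨i, rfl | rfl | rfl | rfl | rfl | rfl⟩ <;> simp [arc]

/-- An interval of differences from column `c` to column `d`, of length `len.1 * r + len.2`,
starting at `lo.1 * r + lo.2`. -/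
structure Segment where
  c : ℕ
  d : ℕ
  lo : ℤ × ℤ
  len : ℕ × ℕ

/-- The value at `r` of a linear polynomial, modulo `12 * r + 10`. -/
def linearMod (r : ℕ) (p : ℤ × ℤ) : ZMod (12 * r + 10) := ((p.1 * r + p.2 : ℤ) : ZMod _)

/-- Linear polynomials that differ by an integer multiple of `12 * r + 10`. -/
def LinearCongr (p p' : ℤ × ℤ) : Prop := p - p' = (12 * ((p.1 - p'.1) / 12), 10 * ((p.1 - p'.1) / 12))

instance (p p' : ℤ × ℤ) : Decidable (LinearCongr p p') := inferInstanceAs (Decidable (_ = _))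

theorem linearMod_add (r : ℕ) (p p' : ℤ × ℤ) :
    linearMod r (p + p') = linearMod r p + linearMod r p' := by
  simp only [linearMod, Prod.fst_add, Prod.snd_add]
  push_cast
  ring

theorem LinearCongr.eq {r : ℕ} {p p' : ℤ × ℤ} (h : LinearCongr p p') :
    linearMod r p = linearMod r p' := by
  have h1 := congrArg Prod.fst h
  have h2 := congrArg Prod.snd h
  simp only [Prod.fst_sub, Prod.snd_sub] at h1 h2
  have h3 : p.1 * r + p.2 - (p'.1 * r + p'.2) = (p.1 - p'.1) / 12 * (12 * r + 10 : ℕ) := by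
    push_cast
    linear_combination (r : ℤ) * h1 + h2
  rw [← sub_eq_zero, linearMod, linearMod, ← Int.cast_sub, h3, Int.cast_mul, Int.cast_natCast,
    ZMod.natCast_self, mul_zero]

namespace Segment

/-- The differences of a segment, with their reverses. -/
def toSet (r : ℕ) (x : Segment) : Set (ℕ × ℕ × ZMod (12 * r + 10)) :=
  arc x.c x.d (linearMod r x.lo) (x.len.1 * r + x.len.2)

/-- `x` ends before `y` starts, and `y` ends before `x` starts again. -/
def before (x y : Segment) : Bool :=
  x.lo.1 + x.len.1 ≤ y.lo.1 && x.lo.2 + x.len.2 ≤ y.lo.2 &&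
    (y.lo.1 + y.len.1 ≤ x.lo.1 + 12 && y.lo.2 + y.len.2 ≤ x.lo.2 + 10)

/-- A criterion for two segments to be disjoint. -/
def separated (x y : Segment) : Bool :=
  x.c < x.d && y.c < y.d && (x.c != y.c || x.d != y.d || before x y || before y x)

theorem before.linearMod_add_ne {r i j : ℕ} {x y : Segment} (h : before x y = true)
    (hi : i < x.len.1 * r + x.len.2) (hj : j < y.len.1 * r + y.len.2) :
    linearMod r x.lo + i ≠ linearMod r y.lo + j := by
  intro he
  simp only [before, Bool.and_eq_true, decide_eq_true_eq] at h
  obtain ⟨⟨h1, h2⟩, h3, h4⟩ := h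
  have hr : (0 : ℤ) ≤ r := by positivity
  have h5 := mul_le_mul_of_nonneg_right h1 hr
  have h6 := mul_le_mul_of_nonneg_right h3 hr
  zify at hi hj
  simp only [linearMod, ← Int.cast_natCast (R := ZMod (12 * r + 10)), ← Int.cast_add] at he
  rw [ZMod.intCast_eq_intCast_iff_dvd_sub] at he
  have := Int.le_of_dvd (by linarith) he
  push_cast at this
  linarith

theorem separated.not_mem {r : ℕ} {x y : Segment} (h : separated x y = true)
    {a : ℕ × ℕ × ZMod (12 * r + 10)} (hx : a ∈ x.toSet r) : a ∉ y.toSet r := by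
  rintro ⟨j, hj, hb⟩
  obtain ⟨i, hi, ha⟩ := hx
  simp only [separated, Bool.and_eq_true, Bool.or_eq_true, bne_iff_ne, decide_eq_true_eq] at h
  obtain ⟨⟨h1, h2⟩, h3⟩ := h
  have key : x.c = y.c ∧ x.d = y.d ∧ linearMod r x.lo + i = linearMod r y.lo + j := by
    rcases ha with rfl | rfl <;> rcases hb with hb | hb <;>
      simp only [Prod.mk.injEq, neg_inj] at hb
    · exact hb
    · omega
    · omega
    · exact ⟨hb.2.1, hb.1, hb.2.2⟩
  rcases h3 with ((h3 | h3) | h3) | h3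
  · exact h3 key.1
  · exact h3 key.2.1
  · exact before.linearMod_add_ne h3 hi hj key.2.2
  · exact before.linearMod_add_ne h3 hj hi key.2.2.symm

end Segment

/-- A union of disjoint segments filled by triples on the columns `c₀`, `c₁`, `c₂`. With
`q = 2 * r + e`, the differences are two intervals of length `q` starting at `s` and `s'`, on the
first or the second pair of columns, and on the other pairs intervals of length `2 * q`
starting at `t` and `u`. -/
structure LongFamily where
  c₀ : ℕ
  c₁ : ℕ
  c₂ : ℕ
  e : ℕ
  first : Bool
  s : ℤ × ℤ
  s' : ℤ × ℤ
  t : ℤ × ℤ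
  u : ℤ × ℤ

/-- The segments used by a family. -/
def LongFamily.segments (f : LongFamily) : List Segment :=
  bif f.first then
    [⟨f.c₀, f.c₁, f.s, (2, f.e)⟩, ⟨f.c₀, f.c₁, f.s', (2, f.e)⟩, ⟨f.c₁, f.c₂, f.t, (4, 2 * f.e)⟩,
      ⟨f.c₀, f.c₂, f.u, (4, 2 * f.e)⟩]
  else
    [⟨f.c₁, f.c₂, f.s, (2, f.e)⟩, ⟨f.c₁, f.c₂, f.s', (2, f.e)⟩, ⟨f.c₀, f.c₁, f.t, (4, 2 * f.e)⟩,
      ⟨f.c₀, f.c₂, f.u, (4, 2 * f.e)⟩]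

/-- The conditions under which a family is filled by triples. -/
def LongFamily.Valid (f : LongFamily) : Prop :=
  f.c₀ ≠ f.c₁ ∧ f.c₁ ≠ f.c₂ ∧ f.c₀ ≠ f.c₂ ∧ f.e ≤ 2 ∧
    LinearCongr (f.s + f.t + (2, (f.e : ℤ))) f.u ∧
    LinearCongr (f.s + (2, (f.e : ℤ)) + (0, 1)) f.s'

instance (f : LongFamily) : Decidable f.Valid := inferInstanceAs (Decidable (_ ∧ _))

theorem LongFamily.packs {f : LongFamily} (h : f.Valid) (r : ℕ) :
    Packs {a | ∃ x ∈ f.segments, a ∈ x.toSet r} (2 * (2 * r + f.e)) := by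
  obtain ⟨h01, h12, h02, he, h1, h2⟩ := h
  have hq : linearMod r (2, (f.e : ℤ)) = ((2 * r + f.e : ℕ) : ZMod (12 * r + 10)) := by
    simp [linearMod]
  have h1 := h1.eq (r := r)
  have h2 := h2.eq (r := r)
  have h3 : linearMod r (0, 1) = 1 := by simp [linearMod]
  rw [linearMod_add, linearMod_add, hq] at h1 h2
  rw [h3] at h2
  have h4 : 2 * (2 * r + f.e) = 4 * r + 2 * f.e := by ring
  rcases hf : f.first
  · rw [add_comm (linearMod r f.s)] at h1
    refine (packs_arcs_second (by omega) h01 h12 h02 h1 h2).mono ?_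
    rintro a (((h | h) | h) | h) <;> simp [segments, hf, Segment.toSet, ← h4, h]
  · refine (packs_arcs_first (by omega) h01 h12 h02 h1 h2).mono ?_
    rintro a (((h | h) | h) | h) <;> simp [segments, hf, Segment.toSet, ← h4, h]

/-- A single triple on the columns `c₀`, `c₁`, `c₂` with differences `s`, `t`, `u`. -/
structure SingleTriple where
  c₀ : ℕ
  c₁ : ℕ
  c₂ : ℕ
  s : ℤ × ℤ
  t : ℤ × ℤ
  u : ℤ × ℤ

/-- The segments used by a single triple. -/
def SingleTriple.segments (f : SingleTriple) : List Segment :=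
  [⟨f.c₀, f.c₁, f.s, (0, 1)⟩, ⟨f.c₁, f.c₂, f.t, (0, 1)⟩, ⟨f.c₀, f.c₂, f.u, (0, 1)⟩]

/-- The conditions under which the segments are those of a triple. -/
def SingleTriple.Valid (f : SingleTriple) : Prop :=
  f.c₀ ≠ f.c₁ ∧ f.c₁ ≠ f.c₂ ∧ f.c₀ ≠ f.c₂ ∧ LinearCongr (f.s + f.t) f.u

instance (f : SingleTriple) : Decidable f.Valid := inferInstanceAs (Decidable (_ ∧ _))

theorem SingleTriple.packs {f : SingleTriple} (h : f.Valid) (r : ℕ) :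
    Packs {a | ∃ x ∈ f.segments, a ∈ x.toSet r} 1 := by
  obtain ⟨h01, h12, h02, h1⟩ := h
  have h1 := h1.eq (r := r)
  rw [linearMod_add] at h1
  refine (packs_single h01 h12 h02 h1).mono ?_
  rintro a ((h | h) | h) <;> simp [segments, Segment.toSet, h]

/-- Ten families that cover, with ten single triples, nearly all differences between five
columns. -/
def longFamilies : Fin 10 → LongFamily :=
  ![⟨0, 1, 2, 1, true, (6, 2), (8, 4), (8, 10), (4, 3)⟩,
    ⟨0, 1, 3, 2, true, (2, -3), (4, 0), (2, 5), (6, 4)⟩,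
    ⟨0, 1, 4, 1, false, (6, 2), (8, 4), (10, 5), (6, -2)⟩,
    ⟨0, 2, 3, 1, true, (8, 7), (10, 9), (4, 4), (2, 2)⟩,
    ⟨0, 2, 4, 0, false, (12, 5), (2, -4), (0, 2), (2, -3)⟩,
    ⟨0, 3, 4, 1, true, (10, 9), (0, 1), (10, 2), (10, 2)⟩,
    ⟨1, 2, 3, 1, false, (0, 1), (2, 3), (4, 8), (6, 10)⟩,
    ⟨1, 2, 4, 2, false, (8, 0), (10, 3), (0, 3), (10, 5)⟩,
    ⟨1, 3, 4, 1, false, (2, -4), (4, -2), (10, 12), (2, -1)⟩,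
    ⟨2, 3, 4, 1, true, (8, 6), (10, 8), (6, 0), (4, -3)⟩]

/-- The triples completing `longFamilies`. -/
def singleTriples : Fin 10 → SingleTriple :=
  ![⟨0, 1, 2, (8, 3), (0, 2), (8, 5)⟩,
    ⟨0, 1, 4, (4, -1), (6, 1), (10, 0)⟩,
    ⟨0, 2, 3, (8, 6), (2, 2), (10, 8)⟩,
    ⟨0, 2, 4, (4, 2), (10, 2), (2, -6)⟩,
    ⟨0, 2, 4, (10, 8), (8, -1), (6, -3)⟩,
    ⟨0, 2, 4, (0, 1), (2, -5), (2, -4)⟩,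
    ⟨0, 3, 4, (0, 0), (2, -5), (2, -5)⟩,
    ⟨1, 2, 3, (4, 7), (10, 7), (2, 4)⟩,
    ⟨1, 3, 4, (6, 9), (2, -6), (8, 3)⟩,
    ⟨2, 3, 4, (12, 9), (4, -3), (4, -4)⟩]

theorem longFamilies_valid : ∀ k, (longFamilies k).Valid := by decide +kernel

theorem singleTriples_valid : ∀ k, (singleTriples k).Valid := by decide +kernel

/-- The segments of the families and of the single triples. -/
def allSegments : Fin 10 ⊕ Fin 10 → List Segment :=
  Sum.elim (fun k => (longFamilies k).segments) (fun k => (singleTriples k).segments)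

theorem allSegments_separated : ∀ k k', k ≠ k' → ((allSegments k).all fun x =>
    (allSegments k').all fun y => x.separated y) = true := by
  decide +kernel

/-- The pairs of columns of the two differences left uncovered. -/
def leavePair (c d : ℕ) : Bool := [(0, 2), (2, 0), (2, 3), (3, 2)].contains (c, d)

theorem allSegments_separated_leave : ∀ k, ((allSegments k).all fun x =>
    x.separated ⟨0, 2, (0, 0), (0, 1)⟩ && x.separated ⟨2, 3, (0, 0), (0, 1)⟩) = true := by
  decide +kernel

theorem allSegments_columns : ∀ k, ((allSegments k).all fun x => x.c < x.d && x.d < 5) = true := by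
  decide +kernel

/-- An optimal packing of the differences modulo `12 * r + 10` between five columns. -/
theorem packs_five_columns (r : ℕ) :
    Packs {a : ℕ × ℕ × ZMod (12 * r + 10) | a.1 < 5 ∧ a.2.1 < 5 ∧ a.1 ≠ a.2.1 ∧
      (a.2.2 = 0 → leavePair a.1 a.2.1 = false)} (40 * r + 32) := by
  have key := Packs.iUnion (κ := Fin 10 ⊕ Fin 10)
    (E := fun k => {a | ∃ x ∈ allSegments k, a ∈ x.toSet r})
    (n := Sum.elim (fun k => 2 * (2 * r + (longFamilies k).e)) (fun _ => 1)) ?_ ?_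
  · have hn : ∑ k, Sum.elim (fun k => 2 * (2 * r + (longFamilies k).e)) (fun _ => 1)
        (k : Fin 10 ⊕ Fin 10) = 40 * r + 32 := by
      have he : ∑ k, (longFamilies k).e = 11 := by decide +kernel
      simp only [Fintype.sum_sum_type, Sum.elim_inl, Sum.elim_inr, ← Finset.mul_sum,
        Finset.sum_add_distrib, he, Finset.sum_const, Finset.card_univ, Fintype.card_fin,
        smul_eq_mul]
      ring
    rw [hn] at key
    refine key.mono fun a ha => ?_
    obtain ⟨k, x, hx, ha⟩ := Set.mem_iUnion.1 ha
    have h1 := List.all_eq_true.1 (allSegments_columns k) x hx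
    have h2 := List.all_eq_true.1 (allSegments_separated_leave k) x hx
    simp only [Bool.and_eq_true, decide_eq_true_eq] at h1 h2
    have h3 : leavePair a.1 a.2.1 = true → a.2.2 ≠ 0 := fun hl h0 => by
      have h4 := Segment.separated.not_mem h2.1 ha
      have h5 := Segment.separated.not_mem h2.2 ha
      have h6 : linearMod r (0, 0) = 0 := by simp [linearMod]
      obtain ⟨c, d, g⟩ := a
      simp only at h0 hl
      subst h0
      simp [leavePair] at hl
      rcases hl with ⟨rfl, rfl⟩ | ⟨rfl, rfl⟩ | ⟨rfl, rfl⟩ | ⟨rfl, rfl⟩ <;>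
        simp [Segment.toSet, arc, h6] at h4 h5
    have h4 : a.2.2 = 0 → leavePair a.1 a.2.1 = false := fun h => by
      by_contra hl
      exact h3 (by simpa using hl) h
    obtain ⟨i, hi, rfl | rfl⟩ := ha
    · exact ⟨h1.1.trans h1.2, h1.2, h1.1.ne, h4⟩
    · exact ⟨h1.2, h1.1.trans h1.2, h1.1.ne', h4⟩
  · rintro (k | k)
    · exact LongFamily.packs (longFamilies_valid k) r
    · exact SingleTriple.packs (singleTriples_valid k) r
  · rintro k k' a ⟨x, hx, hax⟩ ⟨y, hy, hay⟩
    by_contra hne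
    have := List.all_eq_true.1 (List.all_eq_true.1 (allSegments_separated k k' hne) x hx) y hy
    exact Segment.separated.not_mem this hax hay

theorem ZMod.nsmul_eq_zero_of_coprime {n m : ℕ} (h : n.Coprime m) (x : ZMod m) (hx : n • x = 0) :
    x = 0 := by
  rw [nsmul_eq_mul] at hx
  exact ((ZMod.isUnit_iff_coprime n m).2 h).mul_right_eq_zero.1 hx

theorem coprime_two_six_mul_add_five (r : ℕ) : Nat.Coprime 2 (6 * r + 5) := by
  rw [Nat.coprime_two_left, Nat.odd_iff]; omega

theorem coprime_three_six_mul_add_five (r : ℕ) : Nat.Coprime 3 (6 * r + 5) := by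
  rw [Nat.Prime.coprime_iff_not_dvd Nat.prime_three]; omega

/-- The Chinese remainder isomorphism. -/
noncomputable def crt (r : ℕ) : ZMod (12 * r + 10) ≃+ ZMod 2 × ZMod (6 * r + 5) :=
  ((ZMod.ringEquivCongr (by ring)).trans
    (ZMod.chineseRemainder (m := 2) (n := 6 * r + 5) 
      (coprime_two_six_mul_add_five r))).toAddEquiv

theorem Packs.to_unit {C : Type} {n : ℕ}
    {E : Set (C × C × ZMod 1)} (h : Packs E n) :
    Packs {a : C × C × Unit | (a.1, a.2.1, 0) ∈ E} n :=
  h.map id 0 (fun c d x hx => by obtain rfl := Subsingleton.elim x 0; exact hx)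
    fun c d x c' d' x' _ _ e1 e2 _ => ⟨e1, e2, Subsingleton.elim _ _⟩

theorem packs_split {m : ℕ} [NeZero m] (h2 : Nat.Coprime 2 m) (h3 : Nat.Coprime 3 m) :
    Packs {a : Fin 3 × Fin 3 × (ZMod 2 × ZMod m) | a.1 ≠ a.2.1 ∧ a.2.2 ∈ {g | g.2 ≠ 0}}
      (2 * (m - 1)) := by
  have := packs_three_nonzero (A := ZMod m) (fun x => ZMod.nsmul_eq_zero_of_coprime h2 x)
    (fun x => ZMod.nsmul_eq_zero_of_coprime h3 x)
    (fun t => if t.val < (m + 1) / 2 then 0 else 1) (fun x hx => by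
      rw [ZMod.neg_val, if_neg hx]
      have h1 := ZMod.val_lt x
      have h2 := (Nat.odd_iff.1 (Nat.coprime_two_left.1 h2))
      have h3 : x.val ≠ 0 := (ZMod.val_ne_zero x).2 hx
      split_ifs <;> first | omega | decide)
  rwa [ZMod.card] at this

theorem packs_outside_five :
    Packs {a : ℕ × ℕ × ZMod 2 | (offHole 5 11 a.1 a.2.1 && a.1 != a.2.1 ||
      leavePair a.1 a.2.1 && a.2.2.val == 0) = true} 30 :=
  Packs.of_check (N := 2) (P := fun c d x => offHole 5 11 c d && c != d || leavePair c d && x == 0)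
    (l := [(1,5,9,0,1),(3,5,9,0,0),(3,6,9,0,1),(4,6,7,0,1),(0,2,6,0,1),(0,5,6,1,0),(2,5,7,0,1),
      (2,9,10,1,0),(4,8,9,1,1),(1,7,10,0,0),(2,6,9,0,0),(2,3,10,0,1),(3,8,10,1,0),(1,6,8,0,0),
      (2,5,8,1,0),(0,8,9,1,0),(0,7,9,1,1),(5,6,10,0,1),(0,8,10,0,0),(4,5,7,0,0),(3,7,8,0,0),
      (4,6,8,1,0),(1,6,10,1,1),(4,5,10,1,1),(0,7,10,0,1),(3,6,7,1,1),(1,7,9,1,0),(2,7,8,0,1),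
      (1,5,8,1,1),(4,9,10,0,0)]) (by decide +kernel)

theorem packs_eleven_columns (r : ℕ) :
    Packs {a : ℕ × ℕ × (ZMod 2 × ZMod (6 * r + 5)) | a.1 < 11 ∧ a.2.1 < 11 ∧ a.1 ≠ a.2.1}
      (220 * r + 182) := by
  have h1 := packs_triangles.to_unit.compose (packs_split (coprime_two_six_mul_add_five r)
    (coprime_three_six_mul_add_five r))
  have h2 := packs_outside_five.map_injective (φ := id)
    (ψ := AddMonoidHom.inl (ZMod 2) (ZMod (6 * r + 5)))
    (E' := {a | (offHole 5 11 a.1 a.2.1 ∧ a.1 ≠ a.2.1 ∨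
      leavePair a.1 a.2.1 ∧ a.2.2.1 = 0) ∧ a.2.2.2 = 0}) Function.injective_id
    (fun x y h => by simpa using h) (fun c d x hx => by simpa using! hx)
  have h3 := (packs_five_columns r).map_injective (φ := id) (ψ := (crt r).toAddMonoidHom)
    (E' := {a | a.1 < 5 ∧ a.2.1 < 5 ∧ a.1 ≠ a.2.1 ∧ (a.2.2 = 0 → leavePair a.1 a.2.1 = false)})
    Function.injective_id (crt r).injective
    (fun c d x hx => ⟨hx.1, hx.2.1, hx.2.2.1, fun h => hx.2.2.2 ((crt r).map_eq_zero_iff.1 h)⟩)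
  have key := (h1.union h2 fun a h h' => h.2 h'.2).union h3 ?_
  · rw [show 15 * (2 * (6 * r + 5 - 1)) + 30 + (40 * r + 32) = 220 * r + 182 by omega] at key
    refine key.mono ?_
    rintro ⟨c, d, x⟩ ((h | h) | h)
    · have h := h.1
      simp [offHole] at h
      exact ⟨h.1.1.1, h.1.1.2, h.2⟩
    · have h := h.1
      simp [offHole, leavePair] at h ⊢
      omega
    · simp at h ⊢
      omega
  · rintro ⟨c, d, x⟩ (h | h) h'
    · have h := h.1
      simp [offHole] at h h'
      omega
    · obtain ⟨h | h, h0⟩ := h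
      · simp [offHole] at h h'
        omega
      · have := h'.2.2.2 (Prod.ext h.2 h0)
        simp_all

/-- Filling the groups of a packing on `k` groups of `g` columns, with `h` common further
columns. -/
theorem Packs.fill {Γ : Type} [AddCommGroup Γ] {g h k n₁ n₂ : ℕ} {L : Prop} {W : Set Γ}
    (h₁ : Packs {a : ℕ × ℕ × Γ | (a.1 < g * k ∧ a.2.1 < g * k ∧ a.1 / g ≠ a.2.1 / g) ∧
      a.2.2 ∈ W} n₁)
    (h₂ : Packs {a : ℕ × ℕ × Γ | offHole h (h + g) a.1 a.2.1 ∧ (a.1 = a.2.1 → L) ∧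
      a.2.2 ∈ W} n₂) :
    Packs {a : ℕ × ℕ × Γ | offHole h (h + g * k) a.1 a.2.1 ∧ (a.1 = a.2.1 → L) ∧
      a.2.2 ∈ W} (n₁ + k * n₂) := by
  have h₁' := h₁.map_injective (φ := fun c => h + c) (ψ := AddMonoidHom.id Γ)
    (E' := {a | h ≤ a.1 ∧ h ≤ a.2.1 ∧ a.1 < h + g * k ∧ a.2.1 < h + g * k ∧
      (a.1 - h) / g ≠ (a.2.1 - h) / g ∧ a.2.2 ∈ W}) (add_right_injective h)
    Function.injective_id
    (fun c d x hx => ⟨by simp, by simp, by simpa using! hx.1.1, by simpa using! hx.1.2.1,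
      by simpa using! hx.1.2.2, hx.2⟩)
  have h₂' := Packs.iUnion_const (κ := Fin k)
    (E := fun x => {a | offHole h (h + g * k) a.1 a.2.1 ∧ (a.1 = a.2.1 → L) ∧
      (h ≤ a.1 → (a.1 - h) / g = x) ∧ (h ≤ a.2.1 → (a.2.1 - h) / g = x) ∧ a.2.2 ∈ W})
    (fun x => h₂.map_injective (φ := fun c => if c < h then c else c + g * x)
      (ψ := AddMonoidHom.id Γ) (fun c d hcd => by
        simp only at hcd
        split_ifs at hcd <;> omega) Function.injective_id (fun c d y hx => by
          have hx' : g * (x : ℕ) + g ≤ g * k := by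
            rw [← mul_add_one]; exact Nat.mul_le_mul_left g x.2
          have hdiv : ∀ c, c < h + g → h ≤ c → (c + g * x - h) / g = x := fun c h1 h2 => by
            rw [show c + g * x - h = c - h + g * x by omega, Nat.add_mul_div_left _ _ (by omega),
              Nat.div_eq_of_lt (by omega), zero_add]
          obtain ⟨h1, h2, h3⟩ := hx
          simp only [offHole, Bool.and_eq_true, Bool.or_eq_true, decide_eq_true_eq] at h1
          simp only [Set.mem_ofPred_eq, offHole, Bool.and_eq_true, Bool.or_eq_true,
            decide_eq_true_eq]
          refine ⟨?_, fun he => h2 ?_, ?_, ?_, h3⟩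
          · split_ifs <;> omega
          · change c = d
            split_ifs at he <;> omega
          · split_ifs with hc
            · omega
            · exact fun _ => hdiv c h1.1.1 (not_lt.1 hc)
          · split_ifs with hd
            · omega
            · exact fun _ => hdiv d h1.1.2 (not_lt.1 hd)))
    (fun x x' a ha ha' => by
      obtain ⟨h1, -, h2, h3, -⟩ := ha
      obtain ⟨-, -, h4, h5, -⟩ := ha'
      simp only [offHole, Bool.and_eq_true, Bool.or_eq_true, decide_eq_true_eq] at h1
      rcases h1.2 with h | h
      · exact Fin.ext ((h2 h).symm.trans (h4 h))
      · exact Fin.ext ((h3 h).symm.trans (h5 h)))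
  rw [Fintype.card_fin] at h₂'
  refine (h₁'.union h₂' fun a ha ha' => ?_).mono ?_
  · obtain ⟨x, -, -, h2, h3, -⟩ := Set.mem_iUnion.1 ha'
    exact ha.2.2.2.2.1 ((h2 ha.1).trans (h3 ha.2.1).symm)
  · rintro a (ha | ha)
    · obtain ⟨h1, h2, h3, h4, h5, h6⟩ := ha
      refine ⟨by simp [offHole]; omega, fun he => absurd (by rw [he]) h5, h6⟩
    · obtain ⟨x, h1, h2, -, -, h3⟩ := Set.mem_iUnion.1 ha
      exact ⟨h1, h2, h3⟩

theorem packs_sixfold {k : ℕ} (hk : k ≠ 2) :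
    Packs {a : ℕ × ℕ × Unit | a.1 < 6 * k ∧ a.2.1 < 6 * k ∧ a.1 / 6 ≠ a.2.1 / 6}
      (6 * k * (k - 1)) := by
  have h := Packs.sixfold (X := Fin k) (by simpa)
  rw [Fintype.card_fin] at h
  refine h.map_injective (φ := fun c => 6 * c.1.val + 2 * c.2.1.val + c.2.2.val)
    (ψ := AddMonoidHom.id Unit) ?_ Function.injective_id ?_
  · rintro ⟨x, i, α⟩ ⟨x', i', α'⟩ h
    have h1 := ZMod.val_lt α
    have h2 := ZMod.val_lt α'
    simp only at h
    refine Prod.ext (Fin.ext ?_) (Prod.ext (Fin.ext ?_) (ZMod.val_injective 2 ?_)) <;>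
      simp only <;> omega
  · rintro ⟨x, i, α⟩ ⟨x', i', α'⟩ y hne
    have h1 := ZMod.val_lt α
    have h2 := ZMod.val_lt α'
    have h3 : x.val ≠ x'.val := fun he => hne (Fin.ext he)
    simp only [Set.mem_ofPred_eq]
    omega

/-- Optimal packings of `ℤ/2` on `12 * k + 11` columns with a hole on `11` columns. -/
theorem packs_twelvefold (k : ℕ) :
    Packs {a : ℕ × ℕ × ZMod 2 | offHole 11 (11 + 12 * k) a.1 a.2.1 ∧ a.1 ≠ a.2.1}
      (48 * k ^ 2 + 84 * k) := by
  by_cases hk : k = 2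
  · subst hk
    exact packs_triples35.mono fun a ha => by simpa using! ha
  · have h₁ := ((packs_sixfold hk).compose packs_three_klein).unfold.map_injective
      (φ := fun c : ℕ × ZMod 2 => 2 * c.1 + c.2.val) (ψ := AddMonoidHom.id (ZMod 2))
      (E' := {a | (a.1 < 12 * k ∧ a.2.1 < 12 * k ∧ a.1 / 12 ≠ a.2.1 / 12) ∧ a.2.2 ∈ Set.univ})
      ?_ Function.injective_id ?_
    · have h₂ : Packs {a : ℕ × ℕ × ZMod 2 | offHole 11 (11 + 12) a.1 a.2.1 ∧
          (a.1 = a.2.1 → False) ∧ a.2.2 ∈ Set.univ} 132 :=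
        packs_triples23.mono fun a ha => by simpa using! ha
      have h := h₁.fill h₂
      rw [show 6 * k * (k - 1) * 4 * Fintype.card (ZMod 2) + k * 132 = 48 * k ^ 2 + 84 * k by
        rcases k with _ | k
        · rfl
        · rw [ZMod.card, Nat.add_sub_cancel]; ring] at h
      exact h.mono fun a ha => ⟨ha.1, ha.2.1⟩
    · rintro ⟨x, α⟩ ⟨x', α'⟩ h
      have h1 := ZMod.val_lt α
      have h2 := ZMod.val_lt α'
      simp only at h
      refine Prod.ext ?_ (ZMod.val_injective 2 ?_) <;> simp only <;> omega
    · rintro ⟨x, α⟩ ⟨x', α'⟩ y ⟨h, -⟩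
      have h1 := ZMod.val_lt α
      have h2 := ZMod.val_lt α'
      simp only [Set.mem_ofPred_eq] at h
      simp only [Set.mem_ofPred_eq, Set.mem_univ, and_true]
      omega

/-- The residues modulo `22` that are nonzero modulo `11`. -/
def nonmultiples : Set (ZMod 22) := {x | x.val % 11 ≠ 0}

theorem packs_three_nonmultiples :
    Packs {a : Fin 3 × Fin 3 × ZMod 22 | a.1 ≠ a.2.1 ∧ a.2.2 ∈ nonmultiples} 20 := by
  refine packs_triplesThree.map (fun c => ⟨c % 3, Nat.mod_lt _ (by norm_num)⟩)
    (AddMonoidHom.id _) ?_ ?_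
  · intro c d x hx
    simp [offHole, nonmultiples] at hx ⊢
    omega
  · intro c d x c' d' x' hx hx' e1 e2 e3
    simp [offHole] at hx hx' e1 e2
    exact ⟨by omega, by omega, e3⟩

theorem packs_with_hole {h g k n₁ n₂ : ℕ}
    (h₁ : Packs {a : ℕ × ℕ × Unit | a.1 < g * k ∧ a.2.1 < g * k ∧ a.1 / g ≠ a.2.1 / g} n₁)
    (h₂ : Packs {a : ℕ × ℕ × ZMod 22 |
      (offHole h (h + g) a.1 a.2.1 && a.2.2.val % 11 != 0) = true} n₂) :
    Packs {a : ℕ × ℕ × ZMod 22 | offHole h (h + g * k) a.1 a.2.1 ∧ a.2.2 ∈ nonmultiples}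
      (n₁ * 20 + k * n₂) :=
  ((h₁.compose packs_three_nonmultiples).fill (L := True) (h₂.mono fun a ha => by
    simpa [nonmultiples] using! ha)).mono fun _ ha => ⟨ha.1, ha.2.2⟩

/-- Optimal packings, loops included, of the nonzero residues modulo `11` in `ℤ/22`, with a hole
on one column. -/
theorem packs_nonmultiples {v : ℕ} (hv : v % 6 = 1 ∨ v % 6 = 5) :
    Packs {a : ℕ × ℕ × ZMod 22 | offHole 1 v a.1 a.2.1 ∧ a.2.2 ∈ nonmultiples}
      (10 * (v ^ 2 - 1) / 3) := by
  by_cases h13 : v = 13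
  · subst h13
    exact packs_with_hole (h := 1) (g := 4) (k := 3) (packs_blocks444.to_unit.mono fun a ha => by
      simp [offHole] at ha ⊢; omega) packs_orbits5
  by_cases h17 : v = 17
  · subst h17
    exact packs_with_hole (h := 1) (g := 4) (k := 4) (packs_blocks4444.to_unit.mono fun a ha => by
      simp [offHole] at ha ⊢; omega) packs_orbits5
  rcases hv with hv | hv
  · obtain ⟨t, rfl⟩ : ∃ t, v = 1 + 6 * t := ⟨v / 6, by omega⟩
    have h := packs_with_hole (packs_sixfold (k := t) (by omega)) packs_orbits7
    have : 10 * ((1 + 6 * t) ^ 2 - 1) = 3 * (120 * t ^ 2 + 40 * t) := by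
      rw [show (1 + 6 * t) ^ 2 = 36 * t ^ 2 + 12 * t + 1 by ring, Nat.add_sub_cancel]; ring
    rw [this, Nat.mul_div_cancel_left _ (by norm_num)]
    rwa [show 6 * t * (t - 1) * 20 + t * 160 = 120 * t ^ 2 + 40 * t by
      rcases t with _ | t
      · rfl
      · rw [Nat.add_sub_cancel]; ring] at h
  · obtain ⟨t, rfl⟩ : ∃ t, v = 5 + 6 * t := ⟨v / 6, by omega⟩
    have h := packs_with_hole (packs_sixfold (k := t) (by omega)) packs_orbits11
    have : 10 * ((5 + 6 * t) ^ 2 - 1) = 3 * (120 * t ^ 2 + 200 * t + 80) := by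
      rw [show (5 + 6 * t) ^ 2 = 36 * t ^ 2 + 60 * t + 24 + 1 by ring, Nat.add_sub_cancel]; ring
    rw [this, Nat.mul_div_cancel_left _ (by norm_num)]
    rw [show 6 * t * (t - 1) * 20 + t * 320 = 120 * t ^ 2 + 200 * t by
      rcases t with _ | t
      · rfl
      · rw [Nat.add_sub_cancel]; ring] at h
    refine (h.union packs_orbits5 ?_).mono ?_
    · intro a ha ha'
      have ha := ha.1
      simp [offHole] at ha ha'
      omega
    · rintro a (ha | ha)
      · obtain ⟨h1, h2⟩ := ha
        refine ⟨?_, h2⟩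
        simp [offHole] at h1 ⊢
        omega
      · simp [offHole, nonmultiples] at ha ⊢
        omega

theorem add_self_eq_zero_of_coprime {m : ℕ} (h : Nat.Coprime 2 m) (x : ZMod m)
    (hx : x + x = 0) : x = 0 :=
  ZMod.nsmul_eq_zero_of_coprime h x (by rwa [two_nsmul])

/-- The homomorphism `ℤ/22 × ℤ/m → (ℤ/2 × ℤ/m) × ℤ/11` given by reduction. -/
def splitEleven (m : ℕ) : ZMod 22 × ZMod m →+ (ZMod 2 × ZMod m) × ZMod 11 :=
  (((ZMod.castHom (by norm_num : 2 ∣ 22) (ZMod 2)).toAddMonoidHom.comp (.fst _ _)).prod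
    (.snd _ _)).prod ((ZMod.castHom (by norm_num : 11 ∣ 22) (ZMod 11)).toAddMonoidHom.comp
      (.fst _ _))

theorem splitEleven_apply (m : ℕ) (x : ZMod 22 × ZMod m) :
    splitEleven m x = ((ZMod.castHom (by norm_num : 2 ∣ 22) (ZMod 2) x.1, x.2),
      ZMod.castHom (by norm_num : 11 ∣ 22) (ZMod 11) x.1) := rfl

theorem splitEleven_injective (m : ℕ) : Function.Injective (splitEleven m) := by
  have key : ∀ x y : ZMod 22, ZMod.castHom (by norm_num : 2 ∣ 22) (ZMod 2) x =
      ZMod.castHom (by norm_num : 2 ∣ 22) (ZMod 2) y →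
      ZMod.castHom (by norm_num : 11 ∣ 22) (ZMod 11) x =
      ZMod.castHom (by norm_num : 11 ∣ 22) (ZMod 11) y → x = y := by decide +kernel
  intro x y h
  simp only [splitEleven_apply, Prod.mk.injEq] at h
  exact Prod.ext (key _ _ h.1.1 h.2) h.1.2

theorem castHom_ne_zero_of_mem_nonmultiples : ∀ x : ZMod 22, x ∈ nonmultiples →
    ZMod.castHom (by norm_num : 11 ∣ 22) (ZMod 11) x ≠ 0 := by
  unfold nonmultiples
  simp only [Set.mem_ofPred_eq]
  decide +kernel

/-- The differences between two of `12 * k + 11` groups of `v` columns, one of the groups not being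
among the first `11`. -/
theorem packs_outside {v m : ℕ} [NeZero v] [NeZero m] (hv : Nat.Coprime 2 v)
    (hm : Nat.Coprime 2 m) (k : ℕ) :
    Packs {a : (ℕ × ℕ) × (ℕ × ℕ) × (ZMod 2 × ZMod m) |
      offHole 11 (11 + 12 * k) a.1.1 a.2.1.1 ∧ a.1.1 ≠ a.2.1.1 ∧ a.1.2 < v ∧ a.2.1.2 < v}
      ((48 * k ^ 2 + 84 * k) * m * v ^ 2) := by
  have h := (((packs_twelvefold k).inflate (A := ZMod m) (add_self_eq_zero_of_coprime hm)).inflate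
    (A := ZMod v) (add_self_eq_zero_of_coprime hv)).unfold
  rw [ZMod.card, ZMod.card, mul_assoc _ v v, ← sq] at h
  exact h.map_injective (φ := fun c => (c.1, c.2.val)) (ψ := AddMonoidHom.id _)
    (fun c d hcd => Prod.ext (congrArg (fun p : ℕ × ℕ => p.1) hcd)
      (ZMod.val_injective v (congrArg (fun p : ℕ × ℕ => p.2) hcd))) Function.injective_id
    fun c d x hx => ⟨hx.1, hx.2, ZMod.val_lt _, ZMod.val_lt _⟩

/-- The differences between two of `11` groups of `v` columns, that are not both the zeroth columns
of their groups. -/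
theorem packs_inside {v m : ℕ} [NeZero m] (hv : v % 6 = 1 ∨ v % 6 = 5) (hm : Nat.Coprime 2 m) :
    Packs {a : (ℕ × ℕ) × (ℕ × ℕ) × (ZMod 2 × ZMod m) |
      a.1.1 < 11 ∧ a.2.1.1 < 11 ∧ a.1.1 ≠ a.2.1.1 ∧ offHole 1 v a.1.2 a.2.1.2}
      (10 * (v ^ 2 - 1) / 3 * m * 11) := by
  have h := (((packs_nonmultiples hv).inflate (A := ZMod m)
    (add_self_eq_zero_of_coprime hm)).map_injective (φ := id) (ψ := splitEleven m)
      (E' := {a | offHole 1 v a.1 a.2.1 ∧ a.2.2.2 ≠ 0}) Function.injective_id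
      (splitEleven_injective m)
      fun c d x hx => ⟨hx.1, castHom_ne_zero_of_mem_nonmultiples _ hx.2⟩).unfold
  rw [ZMod.card, ZMod.card] at h
  exact h.map_injective (φ := fun c => (c.2.val, c.1)) (ψ := AddMonoidHom.id _)
    (fun c d hcd => Prod.ext (congrArg (fun p : ℕ × ℕ => p.2) hcd)
      (ZMod.val_injective 11 (congrArg (fun p : ℕ × ℕ => p.1) hcd))) Function.injective_id
    fun c d x hx => ⟨ZMod.val_lt c.2, ZMod.val_lt d.2,
      fun he => hx.2 (sub_eq_zero.2 (ZMod.val_injective 11 he).symm), hx.1⟩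

/-- The differences between any two of `12 * k + 11` groups of `v` columns. -/
theorem packs_all {v : ℕ} (hv : v % 6 = 1 ∨ v % 6 = 5) (k r : ℕ) :
    Packs {a : (Fin (12 * k + 11) × Fin v) × (Fin (12 * k + 11) × Fin v) × ZMod (12 * r + 10) |
      a.1.1 ≠ a.2.1.1}
      ((48 * k ^ 2 + 84 * k) * (6 * r + 5) * v ^ 2 + 10 * (v ^ 2 - 1) / 3 * (6 * r + 5) * 11 +
        (220 * r + 182)) := by
  have : NeZero v := ⟨by omega⟩
  have hv2 : Nat.Coprime 2 v := by rw [Nat.coprime_two_left, Nat.odd_iff]; omega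
  have hm := coprime_two_six_mul_add_five r
  have h₁ := packs_outside hv2 hm k
  have h₂ := packs_inside (v := v) hv hm
  have h₃ := (packs_eleven_columns r).map_injective (φ := fun c => (c, 0))
    (ψ := AddMonoidHom.id _) (E' := {a : (ℕ × ℕ) × (ℕ × ℕ) × (ZMod 2 × ZMod (6 * r + 5)) |
      a.1.1 < 11 ∧ a.2.1.1 < 11 ∧ a.1.1 ≠ a.2.1.1 ∧ a.1.2 = 0 ∧ a.2.1.2 = 0})
    (fun c d hcd => congrArg Prod.fst hcd) Function.injective_id
    fun c d x hx => ⟨hx.1, hx.2.1, hx.2.2, rfl, rfl⟩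
  have h := (h₁.union h₂ ?_).union h₃ ?_
  · refine (h.mono (E' := {a | (a.1.1 < 12 * k + 11 ∧ a.1.2 < v) ∧
      (a.2.1.1 < 12 * k + 11 ∧ a.2.1.2 < v) ∧ a.1.1 ≠ a.2.1.1}) ?_).map
      (fun c => (⟨c.1 % (12 * k + 11), Nat.mod_lt _ (by omega)⟩,
        ⟨c.2 % v, Nat.mod_lt _ (NeZero.pos v)⟩)) (crt r).symm.toAddMonoidHom ?_ ?_
    · rintro a ((h | h) | h) <;> simp [offHole] at h ⊢ <;> omega
    · rintro c d x ⟨h1, h2, h3⟩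
      simpa [Nat.mod_eq_of_lt h1.1, Nat.mod_eq_of_lt h2.1] using! h3
    · rintro c d x c' d' x' ⟨h1, h2, -⟩ ⟨h1', h2', -⟩ e1 e2 e3
      simp only [Prod.mk.injEq, Fin.mk.injEq, Nat.mod_eq_of_lt h1.1, Nat.mod_eq_of_lt h1.2,
        Nat.mod_eq_of_lt h2.1, Nat.mod_eq_of_lt h2.2, Nat.mod_eq_of_lt h1'.1,
        Nat.mod_eq_of_lt h1'.2, Nat.mod_eq_of_lt h2'.1, Nat.mod_eq_of_lt h2'.2] at e1 e2
      exact ⟨Prod.ext e1.1 e1.2, Prod.ext e2.1 e2.2, (crt r).symm.injective e3⟩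
  · rintro a h h'
    simp [offHole] at h h'
    omega
  · rintro a (h | h) h' <;> simp [offHole] at h h' <;> omega

theorem Jstar_eq {v : ℕ} (hv : v % 6 = 1 ∨ v % 6 = 5) (k r : ℕ) :
    Jstar (12 * k + 11) v (12 * r + 10) = (48 * k ^ 2 + 84 * k) * (6 * r + 5) * v ^ 2 +
      10 * (v ^ 2 - 1) / 3 * (6 * r + 5) * 11 + (220 * r + 182) := by
  obtain ⟨s, hs⟩ : ∃ s, v ^ 2 = 12 * s + 1 := by
    rcases hv with hv | hv
    · exact ⟨3 * (v / 6) ^ 2 + v / 6, by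
        rw [show v = 6 * (v / 6) + 1 by omega, show (6 * (v / 6) + 1) / 6 = v / 6 by omega]; ring⟩
    · exact ⟨3 * (v / 6) ^ 2 + 5 * (v / 6) + 2, by
        rw [show v = 6 * (v / 6) + 5 by omega, show (6 * (v / 6) + 5) / 6 = v / 6 by omega]; ring⟩
  have hu : 12 * k + 11 - 1 = 12 * k + 10 := rfl
  have hcond : (12 * k + 10) * v ^ 2 * (12 * r + 10) % 6 = 4 := by
    rw [hs]; simp [Nat.mul_mod, Nat.add_mod]
  have hhalf : v * (12 * r + 10) * (12 * k + 10) / 2 = v * (6 * r + 5) * (12 * k + 10) := by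
    rw [show v * (12 * r + 10) * (12 * k + 10) = v * (6 * r + 5) * (12 * k + 10) * 2 by ring,
      Nat.mul_div_cancel _ (by norm_num)]
  have hnum : (12 * k + 11) * v * (v * (6 * r + 5) * (12 * k + 10)) =
      3 * ((48 * k ^ 2 + 84 * k) * (6 * r + 5) * v ^ 2 + 40 * s * (6 * r + 5) * 11 +
        (220 * r + 183)) + 1 := by
    rw [show (12 * k + 11) * v * (v * (6 * r + 5) * (12 * k + 10)) =
      (12 * k + 11) * (6 * r + 5) * (12 * k + 10) * v ^ 2 by ring, hs]
    ring
  rw [Jstar, if_pos (by rw [hu]; omega), J, hu, hhalf, hnum, hs, Nat.add_sub_cancel,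
    show 10 * (12 * s) / 3 = 40 * s by omega]
  omega

/-- Let u ≡ 11 (mod 12), v ≡ 1 or 5 (mod 6), and w ≡ 10 (mod 12)
be positive integers. Then there exists a w-cyclic 3-GDP of type (vw)^u with
J*(u×v×w,3,1) base blocks. -/
theorem exists_cyclic_gdp_u_eleven_mod_twelve
    (u v w : ℕ) (hu0 : 0 < u) (hv0 : 0 < v) (hw0 : 0 < w)
    (hu : u % 12 = 11) (hv : v % 6 = 1 ∨ v % 6 = 5) (hw : w % 12 = 10) :
    ∃ ℬ : Finset (Finset (Fin u × Fin v × ZMod w)),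
      IsCyclicGDP u v w 3 (Jstar u v w) ℬ := by
  obtain ⟨k, rfl⟩ : ∃ k, u = 12 * k + 11 := ⟨u / 12, by omega⟩
  obtain ⟨r, rfl⟩ : ∃ r, w = 12 * r + 10 := ⟨w / 12, by omega⟩
  rw [Jstar_eq hv]
  exact exists_isCyclicGDP_of_packs (packs_all hv k r)
end

section
/- Let u ≡ 2 (mod 6) with u ≥ 8, and let v ≡ 5 (mod 6) and w ≡ 5 (mod 6) be positive integers. Then there exists a w-cyclic 3-GDP of type (vw)^u with J*(u×v×w,3,1) base blocks. -/
set_option maxHeartbeats 800000 in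
/-- Skolem and hooked Skolem sequences, given by the left ends of their pairs. -/
theorem exists_skolem_sequence (s : ℕ) (hs : s = 4 ∨ 6 ≤ s) :
    ∃ a : ℕ → ℕ,
      (∀ r, 1 ≤ r → r ≤ s → 1 ≤ a r) ∧
      (∀ r r', 1 ≤ r → r ≤ s → 1 ≤ r' → r' ≤ s →
        a r ≠ a r' + r' ∧ (a r = a r' → r = r') ∧ (a r + r = a r' + r' → r = r')) ∧
      ((∀ r, 1 ≤ r → r ≤ s → a r + r ≤ 2 * s) ∨
        ∀ r, 1 ≤ r → r ≤ s → a r + r ≤ 2 * s + 1 ∧ a r ≠ 2 * s ∧ a r + r ≠ 2 * s) := by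
  by_cases h4 : s = 4
  · refine ⟨fun r => if r = 1 then 1 else if r = 4 then 3 else r + 2, ?_, ?_, Or.inl ?_⟩
    · intro r _ _; dsimp only; split_ifs <;> lia
    · intro r r' _ _ _ _; dsimp only; split_ifs <;> lia
    · intro r _ _; dsimp only; split_ifs <;> lia
  replace hs : 6 ≤ s := by lia
  clear h4
  obtain ⟨m, h | h | h | h⟩ : ∃ m, s = 4 * m ∨ s = 4 * m + 1 ∨ s = 4 * m + 2 ∨ s + 1 = 4 * m :=
    ⟨(s + 1) / 4, by lia⟩
  · obtain ⟨a, ha⟩ : ∃ a : ℕ → ℕ, ∀ r, a r = if r % 2 = 0 then 6 * m - r / 2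
      else if r = 1 then m
      else if r = 2 * m - 1 then 2 * m
      else if r = 2 * m + 1 then m - 1
      else if r = 4 * m - 1 then 2 * m + 1
      else if r < 2 * m then (4 * m + 1 - r) / 2
      else (4 * m - 1 - r) / 2 := ⟨_, fun _ => rfl⟩
    have key : ∀ r, 1 ≤ r → r ≤ s → (r % 2 = 0 ∧ 2 * a r + r = 12 * m) ∨
        (r = 1 ∧ a r = m) ∨
        (r + 1 = 2 * m ∧ a r = 2 * m) ∨
        (r = 2 * m + 1 ∧ a r + 1 = m) ∨
        (r + 1 = 4 * m ∧ a r = 2 * m + 1) ∨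
        (1 < r ∧ r + 1 < 2 * m ∧ 2 * a r + r = 4 * m + 1) ∨
        (2 * m + 1 < r ∧ r + 1 < 4 * m ∧ 2 * a r + r + 1 = 4 * m) := by
      intro r _ _; rw [ha]; split_ifs <;> lia
    clear ha
    refine ⟨a, fun r h1 h2 => ?_, fun r r' h1 h2 h3 h4 => ?_, Or.inl fun r h1 h2 => ?_⟩
    · have := key r h1 h2
      lia
    · have e := key r h1 h2
      have e' := key r' h3 h4
      clear key
      generalize a r = x at *
      generalize a r' = y at *
      rcases e with e | e | e | e | e | e | e <;>
        refine ⟨?_, ?_, ?_⟩ <;> lia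
    · have := key r h1 h2
      lia
  · obtain ⟨a, ha⟩ : ∃ a : ℕ → ℕ, ∀ r, a r = if r % 2 = 0 then 6 * m + 2 - r / 2
      else if r = 1 then m + 1
      else if r = 2 * m - 1 then 2 * m + 2
      else if r = 4 * m + 1 then 2 * m + 1
      else if r < 2 * m then (4 * m + 3 - r) / 2
      else (4 * m + 1 - r) / 2 := ⟨_, fun _ => rfl⟩
    have key : ∀ r, 1 ≤ r → r ≤ s → (r % 2 = 0 ∧ 2 * a r + r = 12 * m + 4) ∨
        (r = 1 ∧ a r = m + 1) ∨
        (r + 1 = 2 * m ∧ a r = 2 * m + 2) ∨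
        (r = 4 * m + 1 ∧ a r = 2 * m + 1) ∨
        (1 < r ∧ r + 1 < 2 * m ∧ 2 * a r + r = 4 * m + 3) ∨
        (2 * m < r ∧ r < 4 * m + 1 ∧ 2 * a r + r = 4 * m + 1) := by
      intro r _ _; rw [ha]; split_ifs <;> lia
    clear ha
    refine ⟨a, fun r h1 h2 => ?_, fun r r' h1 h2 h3 h4 => ?_, Or.inl fun r h1 h2 => ?_⟩
    · have := key r h1 h2
      lia
    · have e := key r h1 h2
      have e' := key r' h3 h4
      clear key
      generalize a r = x at *
      generalize a r' = y at *
      rcases e with e | e | e | e | e | e <;>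
        refine ⟨?_, ?_, ?_⟩ <;> lia
    · have := key r h1 h2
      lia
  · obtain ⟨a, ha⟩ : ∃ a : ℕ → ℕ, ∀ r, a r = if r = 4 * m + 2 then 4 * m + 3
      else if r % 2 = 0 then 2 * m + 1 - r / 2
      else if r = 1 then 7 * m + 3
      else if r = 2 * m + 1 then 4 * m + 2
      else if r = 4 * m + 1 then 2 * m + 1
      else if r < 2 * m then (12 * m + 5 - r) / 2
      else (12 * m + 7 - r) / 2 := ⟨_, fun _ => rfl⟩
    have key : ∀ r, 1 ≤ r → r ≤ s → (r = 4 * m + 2 ∧ a r = 4 * m + 3) ∨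
        (r < 4 * m + 2 ∧ 2 * a r + r = 4 * m + 2) ∨
        (r = 1 ∧ a r = 7 * m + 3) ∨
        (r = 2 * m + 1 ∧ a r = 4 * m + 2) ∨
        (r = 4 * m + 1 ∧ a r = 2 * m + 1) ∨
        (1 < r ∧ r < 2 * m ∧ 2 * a r + r = 12 * m + 5) ∨
        (2 * m + 1 < r ∧ r < 4 * m + 1 ∧ 2 * a r + r = 12 * m + 7) := by
      intro r _ _; rw [ha]; split_ifs <;> lia
    clear ha
    refine ⟨a, fun r h1 h2 => ?_, fun r r' h1 h2 h3 h4 => ?_, Or.inr fun r h1 h2 => ?_⟩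
    · have := key r h1 h2
      lia
    · have e := key r h1 h2
      have e' := key r' h3 h4
      clear key
      generalize a r = x at *
      generalize a r' = y at *
      rcases e with e | e | e | e | e | e | e <;>
        refine ⟨?_, ?_, ?_⟩ <;> lia
    · have := key r h1 h2
      lia
  · obtain ⟨a, ha⟩ : ∃ a : ℕ → ℕ, ∀ r, a r = if r = 4 * m - 2 then 2 * m + 1
      else if r % 2 = 0 then 6 * m - 1 - r / 2
      else if r = 1 then m
      else if r = 2 * m - 1 then 2 * m
      else if r = 2 * m + 1 then m - 1
      else if r = 4 * m - 1 then 4 * m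
      else if r < 2 * m then (4 * m + 1 - r) / 2
      else (4 * m - 1 - r) / 2 := ⟨_, fun _ => rfl⟩
    have key : ∀ r, 1 ≤ r → r ≤ s → (r + 2 = 4 * m ∧ a r = 2 * m + 1) ∨
        (r + 2 < 4 * m ∧ 2 * a r + r + 2 = 12 * m) ∨
        (r = 1 ∧ a r = m) ∨
        (r + 1 = 2 * m ∧ a r = 2 * m) ∨
        (r = 2 * m + 1 ∧ a r + 1 = m) ∨
        (r + 1 = 4 * m ∧ a r = 4 * m) ∨
        (1 < r ∧ r + 1 < 2 * m ∧ 2 * a r + r = 4 * m + 1) ∨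
        (2 * m + 1 < r ∧ r + 1 < 4 * m ∧ 2 * a r + r + 1 = 4 * m) := by
      intro r _ _; rw [ha]; split_ifs <;> lia
    clear ha
    refine ⟨a, fun r h1 h2 => ?_, fun r r' h1 h2 h3 h4 => ?_, Or.inr fun r h1 h2 => ?_⟩
    · have := key r h1 h2
      lia
    · have e := key r h1 h2
      have e' := key r' h3 h4
      clear key
      generalize a r = x at *
      generalize a r' = y at *
      rcases e with e | e | e | e | e | e | e | e <;>
        refine ⟨?_, ?_, ?_⟩ <;> lia
    · have := key r h1 h2
      lia

/-- Two is invertible modulo an odd number. -/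
theorem ZMod.exists_mul_two_eq_one (t : ℕ) : ∃ h : ZMod (2 * t + 1), h * 2 = 1 := by
  refine ⟨((t + 1 : ℕ) : ZMod (2 * t + 1)), ?_⟩
  have : ((2 * t + 1 : ℕ) : ZMod (2 * t + 1)) = 0 := ZMod.natCast_self _
  push_cast at this ⊢
  linear_combination this

/-- The Steiner quasigroup of Bose's triple system on `R × ℤ/3`, where `h` is half of one. -/
def boseOp {R : Type*} [CommRing R] [DecidableEq R] (h : R) (p q : R × ZMod 3) : R × ZMod 3 :=
  if p.2 = q.2 then (if p.1 = q.1 then p else ((p.1 + q.1) * h, p.2 + 1))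
  else if q.2 = p.2 + 1 then (if p.1 = q.1 then (p.1, p.2 + 2) else (2 * q.1 - p.1, p.2))
  else (if p.1 = q.1 then (p.1, q.2 + 2) else (2 * p.1 - q.1, q.2))

section Bose

variable {R : Type*} [CommRing R] [DecidableEq R]

theorem boseOp_self (h : R) (p : R × ZMod 3) : boseOp h p p = p := by
  simp [boseOp]

theorem boseOp_comm (h : R) (p q : R × ZMod 3) : boseOp h p q = boseOp h q p := by
  obtain ⟨x, i⟩ := p
  obtain ⟨y, j⟩ := q
  have hj : j = i ∨ j = i + 1 ∨ i = j + 1 := by revert i j; decide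
  have h1 : ∀ i : ZMod 3, i ≠ i + 1 ∧ i + 1 ≠ i ∧ i ≠ i + 1 + 1 := by decide
  by_cases hxy : x = y
  · subst hxy
    rcases hj with rfl | rfl | rfl <;> simp [boseOp, h1]
  · have hyx := Ne.symm hxy
    rcases hj with rfl | rfl | rfl <;> simp [boseOp, h1, hxy, hyx, add_comm x y]

theorem boseOp_boseOp {h : R} (hh : h * 2 = 1) (p q : R × ZMod 3) :
    boseOp h p (boseOp h p q) = q := by
  obtain ⟨x, i⟩ := p
  obtain ⟨y, j⟩ := q
  have hj : j = i ∨ j = i + 1 ∨ i = j + 1 := by revert i j; decide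
  have h1 : ∀ i : ZMod 3, i ≠ i + 1 ∧ i + 1 ≠ i ∧ i ≠ i + 1 + 1 ∧ i ≠ i + 2 ∧ i + 2 ≠ i + 1 ∧
    i + 1 ≠ i + 2 ∧ i + 2 ≠ i ∧ i + 2 + 1 = i ∧ i + 2 + 2 = i + 1 ∧ i + 1 + 2 = i ∧
    i + 1 + 1 = i + 2 := by
    decide
  by_cases hxy : x = y
  · subst hxy
    rcases hj with rfl | rfl | rfl <;> simp [boseOp, h1]
  · have hyx := Ne.symm hxy
    have e1 : x ≠ (x + y) * h := fun e => hxy (by linear_combination 2 * e + (x + y) * hh)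
    have e2 : x ≠ 2 * y - x := fun e => hxy (by linear_combination h * e - (x - y) * hh)
    have e3 : x ≠ 2 * x - y := fun e => hyx (by linear_combination e)
    have e4 : 2 * ((x + y) * h) - x = y := by linear_combination (x + y) * hh
    have e5 : 2 * y * h = y := by linear_combination y * hh
    rcases hj with rfl | rfl | rfl <;> simp [boseOp, h1, hxy, e1, e2, e3, e4, e5]

end Bose

/-- A Steiner quasigroup of order `u + 1 ≡ 3 (mod 6)`, with a marked point `none`. -/
theorem exists_steiner_quasigroup (u : ℕ) (hu : u % 6 = 2) :
    ∃ op : Option (Fin u) → Option (Fin u) → Option (Fin u),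
      (∀ x, op x x = x) ∧ (∀ x y, op x y = op y x) ∧ ∀ x y, op x (op x y) = y := by
  obtain ⟨t, rfl⟩ : ∃ t, u = 6 * t + 2 := ⟨u / 6, by omega⟩
  obtain ⟨h, hh⟩ := ZMod.exists_mul_two_eq_one t
  let e : ZMod (2 * t + 1) × ZMod 3 ≃ Option (Fin (6 * t + 2)) := Fintype.equivOfCardEq (by
    simp [ZMod.card]; ring)
  exact ⟨fun x y => e (boseOp h (e.symm x) (e.symm y)), fun x => by simp [boseOp_self],
    fun x y => by simp [boseOp_comm h (e.symm x)], fun x y => by simp [boseOp_boseOp hh]⟩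

/-- The idempotent law `2 y - x` on `R`, extended by a point `none` along the transversal
`y = x + 1`. -/
def prolongedOp {R : Type*} [CommRing R] [DecidableEq R] : Option R → Option R → Option R
  | some x, some y => if y = x + 1 then none else some (2 * y - x)
  | some x, none => some (x + 2)
  | none, some y => some (y + 1)
  | none, none => none

section Prolonged

variable {R : Type*} [CommRing R] [DecidableEq R] {h : R}

theorem prolongedOp_ne [Nontrivial R] (hh : h * 2 = 1) {p q : Option R} (hpq : p ≠ q) :
    prolongedOp p q ≠ p ∧ prolongedOp p q ≠ q := by
  have h2 : (2 : R) ≠ 0 := fun e => by simp [e] at hh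
  rcases p with _ | x <;> rcases q with _ | y
  · simp at hpq
  · simp [prolongedOp]
  · simp [prolongedOp, h2]
  · have hxy : x ≠ y := by simpa using hpq
    have e1 : 2 * y - x ≠ x := fun e => hxy (by linear_combination (-h) * e - (x - y) * hh)
    have e2 : 2 * y - x ≠ y := fun e => hxy (by linear_combination -e)
    by_cases hy : y = x + 1 <;> simp [prolongedOp, hy]; grind

theorem prolongedOp_right_inj (hh : h * 2 = 1) {p q r : Option R} (hq : p ≠ q) (hr : p ≠ r)
    (he : prolongedOp p q = prolongedOp p r) : q = r := by
  have h1 : ∀ x y : R, x + 2 = 2 * y - x → y = x + 1 := fun x y e => by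
    linear_combination (-h) * e - (y - x - 1) * hh
  have h2 : ∀ x y z : R, 2 * y - x = 2 * z - x → y = z := fun x y z e => by
    linear_combination h * e - (y - z) * hh
  rcases p with _ | x <;> rcases q with _ | y <;> rcases r with _ | z <;>
    simp [prolongedOp] at hq hr he ⊢ <;> grind

theorem prolongedOp_left_inj {p q r : Option R} (hp : p ≠ r) (hq : q ≠ r)
    (he : prolongedOp p r = prolongedOp q r) : p = q := by
  rcases p with _ | x <;> rcases q with _ | y <;> rcases r with _ | z <;>
    simp [prolongedOp] at hp hq he ⊢ <;> grind

end Prolonged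

/-- The off-diagonal part of an idempotent quasigroup of even order `u`. -/
theorem exists_idempotent_quasigroup (u : ℕ) (hu : u % 2 = 0) (hu4 : 4 ≤ u) :
    ∃ f : Fin u → Fin u → Fin u,
      (∀ i j, i ≠ j → f i j ≠ i ∧ f i j ≠ j) ∧
      (∀ i j j', i ≠ j → i ≠ j' → f i j = f i j' → j = j') ∧
      (∀ i i' j, i ≠ j → i' ≠ j → f i j = f i' j → i = i') := by
  obtain ⟨t, rfl⟩ : ∃ t, u = 2 * t + 1 + 1 := ⟨u / 2 - 1, by omega⟩
  have : Fact (1 < 2 * t + 1) := ⟨by omega⟩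
  obtain ⟨h, hh⟩ := ZMod.exists_mul_two_eq_one t
  let e : Option (ZMod (2 * t + 1)) ≃ Fin (2 * t + 1 + 1) :=
    Fintype.equivOfCardEq (by simp [ZMod.card])
  refine ⟨fun i j => e (prolongedOp (e.symm i) (e.symm j)), fun i j hij => ?_,
    fun i j j' h1 h2 heq => ?_, fun i i' j h1 h2 heq => ?_⟩
  · have := prolongedOp_ne hh (e.symm.injective.ne hij)
    exact ⟨fun h => this.1 (e.eq_symm_apply.2 h),
      fun h => this.2 (e.eq_symm_apply.2 h)⟩
  · exact e.symm.injective (prolongedOp_right_inj hh (e.symm.injective.ne h1)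
      (e.symm.injective.ne h2) (e.injective heq))
  · exact e.symm.injective (prolongedOp_left_inj (e.symm.injective.ne h1)
      (e.symm.injective.ne h2) (e.injective heq))

/-- A packing of triples on `u ≡ 2 (mod 6)` points that leaves only a perfect matching uncovered. -/
theorem exists_triple_packing (u : ℕ) (hu : u % 6 = 2) :
    ∃ 𝒯 : Finset (Finset (Fin u)),
      (∀ T ∈ 𝒯, T.card = 3) ∧
      (∀ T ∈ 𝒯, ∀ T' ∈ 𝒯, ∀ i j, i ≠ j → i ∈ T → j ∈ T → i ∈ T' → j ∈ T' → T = T') ∧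
      6 * 𝒯.card = u * (u - 2) := by
  classical
  obtain ⟨op, op_self, op_comm, op_op⟩ := exists_steiner_quasigroup u hu
  have rot : ∀ {i j k : Fin u}, op (some i) (some j) = some k → op (some i) (some k) = some j :=
    fun h => by rw [← h, op_op]
  have swap : ∀ {i j k : Fin u}, op (some i) (some j) = some k → op (some j) (some i) = some k :=
    fun h => by rw [op_comm, h]
  have ne : ∀ {i j k : Fin u}, i ≠ j → op (some i) (some j) = some k → k ≠ i := by
    rintro i j k hij h rfl
    have := rot h
    rw [op_self] at this
    exact hij (Option.some_injective _ this)
  let 𝒯 : Finset (Finset (Fin u)) := Finset.univ.filter fun T =>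
    ∃ i j k, i ≠ j ∧ op (some i) (some j) = some k ∧ T = {i, j, k}
  have key : ∀ T ∈ 𝒯, ∀ a ∈ T, ∀ b ∈ T, a ≠ b →
      ∃ c, op (some a) (some b) = some c ∧ T = {a, b, c} := by
    intro T hT a ha b hb hab
    obtain ⟨i, j, k, hij, h, rfl⟩ := (Finset.mem_filter.1 hT).2
    simp only [Finset.mem_insert, Finset.mem_singleton] at ha hb
    rcases ha with rfl | rfl | rfl <;> rcases hb with rfl | rfl | rfl <;>
      first
      | exact absurd rfl hab
      | exact ⟨_, h, by ext; simp; try tauto⟩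
      | exact ⟨_, rot h, by ext; simp; try tauto⟩
      | exact ⟨_, swap h, by ext; simp; try tauto⟩
      | exact ⟨_, swap (rot h), by ext; simp; try tauto⟩
      | exact ⟨_, rot (swap h), by ext; simp; try tauto⟩
      | exact ⟨_, swap (rot (swap h)), by ext; simp; try tauto⟩
  have card3 : ∀ T ∈ 𝒯, T.card = 3 := by
    intro T hT
    obtain ⟨i, j, k, hij, h, rfl⟩ := (Finset.mem_filter.1 hT).2
    exact Finset.card_eq_three.2 ⟨i, j, k, hij, (ne hij h).symm, (ne hij.symm (swap h)).symm, rfl⟩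
  have uniq : ∀ T ∈ 𝒯, ∀ T' ∈ 𝒯, ∀ i j, i ≠ j → i ∈ T → j ∈ T → i ∈ T' → j ∈ T' → T = T' := by
    intro T hT T' hT' i j hij h1 h2 h3 h4
    obtain ⟨c, hc, rfl⟩ := key T hT i h1 j h2 hij
    obtain ⟨c', hc', rfl⟩ := key T' hT' i h3 j h4 hij
    obtain rfl : c = c' := Option.some_injective _ (hc.symm.trans hc')
    rfl
  refine ⟨𝒯, card3, uniq, ?_⟩
  let E : Finset (Fin u × Fin u) :=
    Finset.univ.filter fun p => p.1 ≠ p.2 ∧ op (some p.1) (some p.2) ≠ none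
  have hE : E = 𝒯.biUnion Finset.offDiag := by
    ext ⟨i, j⟩
    simp only [E, Finset.mem_filter, Finset.mem_univ, true_and, Finset.mem_biUnion,
      Finset.mem_offDiag]
    constructor
    · rintro ⟨hij, h⟩
      obtain ⟨k, hk⟩ := Option.ne_none_iff_exists'.1 h
      exact ⟨{i, j, k}, Finset.mem_filter.2 ⟨Finset.mem_univ _, i, j, k, hij, hk, rfl⟩,
        by simp, by simp, hij⟩
    · rintro ⟨T, hT, hi, hj, hij⟩
      obtain ⟨c, hc, -⟩ := key T hT i hi j hj hij
      exact ⟨hij, by simp [hc]⟩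
  have card_E : E.card = 6 * 𝒯.card := by
    rw [hE, Finset.card_biUnion, Finset.sum_congr rfl (g := fun _ => 6), Finset.sum_const,
      smul_eq_mul, mul_comm]
    · intro T hT
      rw [Finset.offDiag_card, card3 T hT]
    · intro T hT T' hT' hne
      refine Finset.disjoint_left.2 fun p hp hp' => hne ?_
      rw [Finset.mem_offDiag] at hp hp'
      exact uniq T hT T' hT' p.1 p.2 hp.2.2 hp.1 hp.2.1 hp'.1 hp'.2.1
  rw [← card_E, Finset.card_filter, Fintype.sum_prod_type, Finset.sum_congr rfl
    (g := fun _ => u - 2)]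
  · simp
  intro i _
  have h1 : op (some i) none ≠ none := fun h => by
    have h2 := op_op none (some i)
    rw [op_comm none (some i), h, op_self] at h2
    simp at h2
  obtain ⟨i', hi'⟩ := Option.ne_none_iff_exists'.1 h1
  have hne : i ≠ i' := by
    rintro rfl
    have h2 := op_op (some i) none
    rw [hi', op_self] at h2
    simp at h2
  have hj : ∀ j, op (some i) (some j) = none ↔ j = i' := fun j => by
    constructor
    · intro h
      have h2 := op_op (some i) (some j)
      rw [h, hi'] at h2
      exact (Option.some_injective _ h2).symm
    · rintro rfl
      rw [← hi', op_op]
  rw [← Finset.card_filter]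
  have : (Finset.univ.filter fun j => i ≠ j ∧ op (some i) (some j) ≠ none) =
      ({i, i'} : Finset (Fin u))ᶜ := by
    ext j
    simp [hj, eq_comm (a := i)]
  simp only [this, Finset.card_compl, Fintype.card_fin, Finset.card_pair hne]

/-- Base blocks of a cyclic Steiner triple system of order `6 s + 1`. -/
theorem exists_difference_triples (s : ℕ) (hs : s = 4 ∨ 6 ≤ s) :
    ∃ d : Fin s → Fin 3 → ZMod (6 * s + 1),
      ∀ r r' α β α' β', α ≠ β → α' ≠ β' → d r β - d r α = d r' β' - d r' α' →
        r = r' ∧ α = α' ∧ β = β' := by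
  obtain ⟨a, ha1, ha2, ha3⟩ := exists_skolem_sequence s hs
  let o : Fin s → Fin 3 → ℤ := fun r =>
    ![0, ((r + 1 : ℕ) : ℤ), ((a (r + 1) + (r + 1) + s : ℕ) : ℤ)]
  refine ⟨fun r α => (o r α : ZMod (6 * s + 1)), fun r r' α β α' β' h h' he => ?_⟩
  have hdvd : ((6 * s + 1 : ℕ) : ℤ) ∣ (o r β - o r α) - (o r' β' - o r' α') := by
    rw [← ZMod.intCast_zmod_eq_zero_iff_dvd]
    push_cast
    rw [he, sub_self]
  obtain ⟨k, hk⟩ := hdvd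
  have hr : (r : ℕ) + 1 ≤ s := r.2
  have hr' : (r' : ℕ) + 1 ≤ s := r'.2
  have e1 := ha1 (r + 1) (by omega) hr
  have e1' := ha1 (r' + 1) (by omega) hr'
  obtain ⟨e2, e4, e5⟩ := ha2 (r + 1) (r' + 1) (by omega) hr (by omega) hr'
  obtain ⟨e3, -, -⟩ := ha2 (r' + 1) (r + 1) (by omega) hr' (by omega) hr
  have e6 : (a (r + 1) + (r + 1) ≤ 2 * s ∧ a (r' + 1) + (r' + 1) ≤ 2 * s) ∨
      ((a (r + 1) + (r + 1) ≤ 2 * s + 1 ∧ a (r + 1) ≠ 2 * s ∧ a (r + 1) + (r + 1) ≠ 2 * s) ∧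
      (a (r' + 1) + (r' + 1) ≤ 2 * s + 1 ∧ a (r' + 1) ≠ 2 * s ∧
        a (r' + 1) + (r' + 1) ≠ 2 * s)) :=
    ha3.imp (fun H => ⟨H _ (by omega) hr, H _ (by omega) hr'⟩)
      (fun H => ⟨H _ (by omega) hr, H _ (by omega) hr'⟩)
  clear ha1 ha2 ha3 he
  rw [Fin.ext_iff (a := r)]
  simp only [o] at hk
  clear o
  generalize a (r + 1) = x at *
  generalize a (r' + 1) = y at *
  generalize (r : ℕ) = r at *
  generalize (r' : ℕ) = r' at *
  have hk' : k = 0 ∨ k = 1 ∨ k = -1 := by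
    have hb : ∀ (t : ℕ) (z : ℕ) (α β : Fin 3), t + 1 ≤ s → z + (t + 1) ≤ 2 * s + 1 →
        |(![0, ((t + 1 : ℕ) : ℤ), ((z + (t + 1) + s : ℕ) : ℤ)] : Fin 3 → ℤ) β -
          (![0, ((t + 1 : ℕ) : ℤ), ((z + (t + 1) + s : ℕ) : ℤ)] : Fin 3 → ℤ) α| ≤ 3 * s + 1 := by
      intro t z α β _ _
      rw [abs_le]
      fin_cases α <;> fin_cases β <;> simp <;> lia
    have b1 := abs_le.1 (hb r x α β hr (by omega))
    have b2 := abs_le.1 (hb r' y α' β' hr' (by omega))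
    have hs0 : 4 ≤ s := by omega
    have k1 : k < 2 := by
      by_contra hk2
      push_cast at hk b1 b2
      nlinarith
    have k2 : -2 < k := by
      by_contra hk2
      push_cast at hk b1 b2
      nlinarith
    omega
  rcases hk' with rfl | rfl | rfl <;>
  fin_cases α <;> fin_cases β <;> first | exact absurd rfl h | skip
  all_goals
    fin_cases α' <;> fin_cases β' <;> first | exact absurd rfl h' | skip
  all_goals
    simp at hk ⊢
    try lia

/-- Combining triples on `Fin u` with base blocks over `G`: each triple is repeated in every layer,
and each translated base block is expanded along the idempotent quasigroup `f`. -/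
theorem exists_translation_invariant_packing {G : Type*} [AddCommGroup G] [Fintype G]
    [DecidableEq G] {u s : ℕ} (𝒯 : Finset (Finset (Fin u))) (f : Fin u → Fin u → Fin u)
    (d : Fin s → Fin 3 → G)
    (card_𝒯 : ∀ T ∈ 𝒯, T.card = 3)
    (uniq_𝒯 : ∀ T ∈ 𝒯, ∀ T' ∈ 𝒯, ∀ i j, i ≠ j → i ∈ T → j ∈ T → i ∈ T' → j ∈ T' → T = T')
    (f_ne : ∀ i j, i ≠ j → f i j ≠ i ∧ f i j ≠ j)
    (f_right : ∀ i j j', i ≠ j → i ≠ j' → f i j = f i j' → j = j')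
    (f_left : ∀ i i' j, i ≠ j → i' ≠ j → f i j = f i' j → i = i')
    (d_inj : ∀ r r' α β α' β', α ≠ β → α' ≠ β' → d r β - d r α = d r' β' - d r' α' →
      r = r' ∧ α = α' ∧ β = β') :
    ∃ 𝒞 : Finset (Finset (Fin u × G)),
      𝒞.card = Fintype.card G * (𝒯.card + s * (u * (u - 1))) ∧
      (∀ B ∈ 𝒞, B.card = 3) ∧
      (∀ B ∈ 𝒞, ∀ p ∈ B, ∀ q ∈ B, p ≠ q → p.1 ≠ q.1) ∧
      (∀ B ∈ 𝒞, ∀ B' ∈ 𝒞, ∀ p q, p ≠ q → p ∈ B → q ∈ B → p ∈ B' → q ∈ B' → B = B') ∧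
      ∀ B ∈ 𝒞, ∀ g : G, B.image (fun p => (p.1, p.2 + g)) ∈ 𝒞 := by
  classical
  let layer : Finset (Fin u) × G → Finset (Fin u × G) := fun t => t.1.image fun i => (i, t.2)
  have mem_layer : ∀ t p, p ∈ layer t ↔ p.1 ∈ t.1 ∧ p.2 = t.2 := by
    rintro t ⟨i, x⟩
    simp only [layer, Finset.mem_image, Prod.mk.injEq]
    exact ⟨fun ⟨j, hj, h1, h2⟩ => ⟨h1 ▸ hj, h2.symm⟩, fun ⟨h1, h2⟩ => ⟨i, h1, rfl, h2.symm⟩⟩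
  let I := 𝒯 ×ˢ (Finset.univ : Finset G)
  let pt : Fin s × G × Fin u × Fin u → Fin 3 → Fin u × G := fun q α =>
    (![q.2.2.1, q.2.2.2, f q.2.2.1 q.2.2.2] α, q.2.1 + d q.1 α)
  let blk : Fin s × G × Fin u × Fin u → Finset (Fin u × G) := fun q => Finset.univ.image (pt q)
  let K : Finset (Fin s × G × Fin u × Fin u) :=
    Finset.univ ×ˢ Finset.univ ×ˢ Finset.univ.offDiag
  have mem_K : ∀ q, q ∈ K ↔ q.2.2.1 ≠ q.2.2.2 := fun q => by simp [K]
  have d_ne : ∀ r α β, d r α = d r β → α = β := fun r α β h => by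
    by_contra hne
    exact hne (d_inj r r α β β α hne (Ne.symm hne) (by rw [h])).2.1
  have fst_inj : ∀ q ∈ K, ∀ α β, (pt q α).1 = (pt q β).1 → α = β := by
    rintro ⟨r, x, i, j⟩ hq α β h
    have hij : i ≠ j := (mem_K _).1 hq
    have h1 := f_ne i j hij
    fin_cases α <;> fin_cases β <;> simp [pt, hij, hij.symm, h1, h1.1.symm, h1.2.symm] at h ⊢
  have mem_blk : ∀ q p, p ∈ blk q ↔ ∃ α, pt q α = p := fun q p => by simp [blk]
  have snd_ne : ∀ q, ∀ p ∈ blk q, ∀ p' ∈ blk q, p ≠ p' → p.2 ≠ p'.2 := by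
    intro q p hp p' hp' hne h
    obtain ⟨α, rfl⟩ := (mem_blk q p).1 hp
    obtain ⟨β, rfl⟩ := (mem_blk q p').1 hp'
    exact hne (congrArg _ (d_ne _ _ _ (add_left_cancel h)))
  have uniq_blk : ∀ q ∈ K, ∀ q' ∈ K, ∀ p p', p ≠ p' → p ∈ blk q → p' ∈ blk q → p ∈ blk q' →
      p' ∈ blk q' → q = q' := by
    rintro ⟨r, x, i, j⟩ hq ⟨r', x', i', j'⟩ hq' p p' hne h1 h2 h3 h4
    have hij : i ≠ j := (mem_K _).1 hq
    have hij' : i' ≠ j' := (mem_K _).1 hq'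
    obtain ⟨α, rfl⟩ := (mem_blk _ _).1 h1
    obtain ⟨β, rfl⟩ := (mem_blk _ _).1 h2
    obtain ⟨α', e1⟩ := (mem_blk _ _).1 h3
    obtain ⟨β', e2⟩ := (mem_blk _ _).1 h4
    have hαβ : α ≠ β := fun h => hne (h ▸ rfl)
    have hαβ' : α' ≠ β' := fun h => hne (by rw [← e1, ← e2, h])
    have s1 : x' + d r' α' = x + d r α := congrArg Prod.snd e1
    have s2 : x' + d r' β' = x + d r β := congrArg Prod.snd e2
    obtain ⟨rfl, rfl, rfl⟩ := d_inj r r' α β α' β' hαβ hαβ' (by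
      rw [← add_sub_add_left_eq_sub _ _ x, ← s1, ← s2, add_sub_add_left_eq_sub])
    obtain rfl := add_right_cancel s1
    have t1 := congrArg Prod.fst e1
    have t2 := congrArg Prod.fst e2
    have goal : i = i' ∧ j = j' := by
      fin_cases α <;> fin_cases β <;> first | exact absurd rfl hαβ | skip
      all_goals
        simp [pt] at t1 t2
        subst_vars
        first
        | exact ⟨rfl, rfl⟩
        | exact ⟨rfl, f_right _ _ _ hij hij' (by assumption)⟩
        | exact ⟨rfl, f_right _ _ _ hij hij' (Eq.symm (by assumption))⟩
        | exact ⟨f_left _ _ _ hij hij' (by assumption), rfl⟩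
        | exact ⟨f_left _ _ _ hij hij' (Eq.symm (by assumption)), rfl⟩
    rw [goal.1, goal.2]
  have exists_pair : ∀ B : Finset (Fin u × G), B.card = 3 → ∃ p ∈ B, ∃ q ∈ B, p ≠ q := fun B hB =>
    Finset.one_lt_card.1 (by omega)
  have layer_inj : ∀ t : Finset (Fin u) × G, (layer t).card = t.1.card := fun t =>
    Finset.card_image_of_injective _ fun i j h => congrArg Prod.fst h
  have card_blk : ∀ q ∈ K, (blk q).card = 3 := fun q hq => by
    rw [Finset.card_image_of_injective _ fun α β h => fst_inj q hq α β (congrArg Prod.fst h)]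
    simp
  have uniq_layer : ∀ t ∈ I, ∀ t' ∈ I, ∀ p p', p ≠ p' → p ∈ layer t → p' ∈ layer t →
      p ∈ layer t' → p' ∈ layer t' → t = t' := by
    rintro ⟨T, x⟩ ht ⟨T', x'⟩ ht' p p' hne h1 h2 h3 h4
    rw [mem_layer] at h1 h2 h3 h4
    rw [Finset.mem_product] at ht ht'
    refine Prod.ext (uniq_𝒯 T ht.1 T' ht'.1 p.1 p'.1 (fun h => hne (Prod.ext h ?_))
      h1.1 h2.1 h3.1 h4.1) (h1.2.symm.trans h3.2)
    exact h1.2.trans h2.2.symm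
  have card_layer : ∀ t ∈ I, (layer t).card = 3 := fun t ht => by
    rw [layer_inj, card_𝒯 _ (Finset.mem_product.1 ht).1]
  have layer_ne_blk : ∀ t ∈ I, ∀ q, ∀ p p', p ≠ p' → p ∈ layer t → p' ∈ layer t → p ∈ blk q →
      p' ∈ blk q → False := fun t _ q p p' hne h1 h2 h3 h4 =>
    snd_ne q p h3 p' h4 hne (((mem_layer t p).1 h1).2.trans ((mem_layer t p').1 h2).2.symm)
  refine ⟨I.image layer ∪ K.image blk, ?_, ?_, ?_, ?_, ?_⟩
  · rw [Finset.card_union_of_disjoint, Finset.card_image_of_injOn, Finset.card_image_of_injOn]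
    · simp only [I, K, Finset.card_product, Finset.offDiag_card, Finset.card_univ,
        Fintype.card_fin, ← Nat.mul_sub_one]
      ring
    · intro q hq q' hq' h
      obtain ⟨p, hp, p', hp', hne⟩ := exists_pair _ (card_blk q hq)
      exact uniq_blk q hq q' hq' p p' hne hp hp' (h ▸ hp) (h ▸ hp')
    · intro t ht t' ht' h
      obtain ⟨p, hp, p', hp', hne⟩ := exists_pair _ (card_layer t ht)
      exact uniq_layer t ht t' ht' p p' hne hp hp' (h ▸ hp) (h ▸ hp')
    · refine Finset.disjoint_left.2 fun B h1 h2 => ?_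
      obtain ⟨t, ht, rfl⟩ := Finset.mem_image.1 h1
      obtain ⟨q, hq, h⟩ := Finset.mem_image.1 h2
      obtain ⟨p, hp, p', hp', hne⟩ := exists_pair _ (card_layer t ht)
      exact layer_ne_blk t ht q p p' hne hp hp' (h ▸ hp) (h ▸ hp')
  · intro B hB
    rcases Finset.mem_union.1 hB with hB | hB <;> obtain ⟨t, ht, rfl⟩ := Finset.mem_image.1 hB
    · exact card_layer t ht
    · exact card_blk t ht
  · intro B hB p hp p' hp' hne h
    rcases Finset.mem_union.1 hB with hB | hB <;> obtain ⟨t, ht, rfl⟩ := Finset.mem_image.1 hB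
    · exact hne (Prod.ext h (((mem_layer t p).1 hp).2.trans ((mem_layer t p').1 hp').2.symm))
    · obtain ⟨α, rfl⟩ := (mem_blk _ _).1 hp
      obtain ⟨β, rfl⟩ := (mem_blk _ _).1 hp'
      exact hne (congrArg _ (fst_inj t ht α β h))
  · intro B hB B' hB' p p' hne h1 h2 h3 h4
    rcases Finset.mem_union.1 hB with hB | hB <;> obtain ⟨t, ht, rfl⟩ := Finset.mem_image.1 hB <;>
    rcases Finset.mem_union.1 hB' with hB' | hB' <;> obtain ⟨t', ht', rfl⟩ := Finset.mem_image.1 hB'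
    · rw [uniq_layer t ht t' ht' p p' hne h1 h2 h3 h4]
    · exact (layer_ne_blk t ht t' p p' hne h1 h2 h3 h4).elim
    · exact (layer_ne_blk t' ht' t p p' hne h3 h4 h1 h2).elim
    · rw [uniq_blk t ht t' ht' p p' hne h1 h2 h3 h4]
  · intro B hB g
    rcases Finset.mem_union.1 hB with hB | hB <;> obtain ⟨t, ht, rfl⟩ := Finset.mem_image.1 hB
    · refine Finset.mem_union_left _ (Finset.mem_image.2 ⟨(t.1, t.2 + g),
        Finset.mem_product.2 ⟨(Finset.mem_product.1 ht).1, Finset.mem_univ _⟩, ?_⟩)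
      simp only [layer, Finset.image_image]
      rfl
    · refine Finset.mem_union_right _ (Finset.mem_image.2 ⟨(t.1, t.2.1 + g, t.2.2),
        (mem_K _).2 ((mem_K t).1 ht), ?_⟩)
      simp only [blk, Finset.image_image]
      refine Finset.image_congr fun α _ => ?_
      simp [pt, add_right_comm]

/-- Rows of length `w` identify `ZMod (v * w)` with `Fin v × ZMod w`. -/
theorem exists_equiv_zmod_mul (v w : ℕ) [NeZero v] [NeZero w] :
    ∃ e : Fin v × ZMod w ≃ ZMod (v * w), ∀ p, e (p.1, p.2 + 1) = e p + v := by
  let g : Fin v × ZMod w → ZMod (v * w) := fun p => ((p.1.val + v * p.2.val : ℕ) : ZMod (v * w))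
  have hlt : ∀ p : Fin v × ZMod w, p.1.val + v * p.2.val < v * w := fun p => by
    have h1 := p.1.2
    have h2 : v * (p.2.val + 1) ≤ v * w := Nat.mul_le_mul_left v (ZMod.val_lt p.2)
    rw [mul_add] at h2
    omega
  have hg : Function.Injective g := by
    intro p q h
    have h1 : p.1.val + v * p.2.val = q.1.val + v * q.2.val := by
      have := (ZMod.natCast_eq_natCast_iff' _ _ _).1 h
      rwa [Nat.mod_eq_of_lt (hlt p), Nat.mod_eq_of_lt (hlt q)] at this
    have h2 := congrArg (· % v) h1
    simp only [Nat.add_mul_mod_self_left, Nat.mod_eq_of_lt p.1.2, Nat.mod_eq_of_lt q.1.2] at h2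
    refine Prod.ext (Fin.ext h2) (ZMod.val_injective w ?_)
    rw [h2] at h1
    exact Nat.eq_of_mul_eq_mul_left (NeZero.pos v) (Nat.add_left_cancel h1)
  refine ⟨Equiv.ofBijective g ((Fintype.bijective_iff_injective_and_card g).2
    ⟨hg, by simp [ZMod.card]⟩), fun p => ?_⟩
  change ((p.1.val + v * (p.2 + 1).val : ℕ) : ZMod (v * w)) = ((_ : ℕ) : ZMod (v * w)) + v
  rw [← Nat.cast_add, ZMod.natCast_eq_natCast_iff, add_assoc, ← Nat.mul_succ]
  refine Nat.ModEq.add_left _ (Nat.ModEq.mul_left' v ?_)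
  rw [← ZMod.natCast_eq_natCast_iff]
  simp

/-- In the case at hand the bound counts the blocks of the construction. -/
theorem Jstar_eq_s19 {a b s t : ℕ} (ht : 1 ≤ t) (hs : (6 * a + 5) * (6 * b + 5) = 6 * s + 1) :
    Jstar (6 * t + 2) (6 * a + 5) (6 * b + 5) =
      (6 * a + 5) * (t * (6 * t + 2) + s * ((6 * t + 2) * (6 * t + 1))) := by
  have hmod : (6 * t + 2 - 1) * (6 * a + 5) ^ 2 * (6 * b + 5) % 6 = 5 := by
    have h : (6 * t + 2 - 1) * (6 * a + 5) ^ 2 * (6 * b + 5) =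
        6 * ((6 * t + 1) * (6 * a + 5) * s + t * (6 * a + 5) + a) + 5 := by
      rw [show 6 * t + 2 - 1 = 6 * t + 1 by omega, pow_two, mul_assoc, mul_assoc (6 * a + 5), hs]
      ring
    omega
  rw [Jstar, if_neg (by rw [hmod]; omega), J, hs, show 6 * t + 2 - 1 = 6 * t + 1 by omega,
    show (6 * s + 1) * (6 * t + 1) / 2 = 3 * (6 * s * t + s + t) by
      rw [show (6 * s + 1) * (6 * t + 1) = 2 * (3 * (6 * s * t + s + t)) + 1 by ring]; omega,
    mul_left_comm, Nat.mul_div_cancel_left _ (by norm_num)]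
  ring

/-- Let u ≡ 2 (mod 6) with u ≥ 8, and let v ≡ 5 (mod 6) and
w ≡ 5 (mod 6) be positive integers. Then there exists a w-cyclic 3-GDP of
type (vw)^u with J*(u×v×w,3,1) base blocks. -/
theorem exists_cyclic_gdp_u_two_mod_six_v_w_five_mod_six
    (u v w : ℕ) (hu : u % 6 = 2) (hu8 : 8 ≤ u) (hv0 : 0 < v) (hw0 : 0 < w)
    (hv : v % 6 = 5) (hw : w % 6 = 5) :
    ∃ ℬ : Finset (Finset (Fin u × Fin v × ZMod w)),
      IsCyclicGDP u v w 3 (Jstar u v w) ℬ := by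
  classical
  have : NeZero v := ⟨hv0.ne'⟩
  have : NeZero w := ⟨hw0.ne'⟩
  obtain ⟨t, rfl⟩ : ∃ t, u = 6 * t + 2 := ⟨u / 6, by omega⟩
  obtain ⟨a, rfl⟩ : ∃ a, v = 6 * a + 5 := ⟨v / 6, by omega⟩
  obtain ⟨b, rfl⟩ : ∃ b, w = 6 * b + 5 := ⟨w / 6, by omega⟩
  obtain ⟨s, hs, hvw⟩ : ∃ s, (s = 4 ∨ 6 ≤ s) ∧ (6 * a + 5) * (6 * b + 5) = 6 * s + 1 := by
    refine ⟨6 * (a * b) + 5 * a + 5 * b + 4, ?_, by ring⟩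
    omega
  have he_exists := exists_equiv_zmod_mul (6 * a + 5) (6 * b + 5)
  rw [hvw] at he_exists
  obtain ⟨e, he⟩ := he_exists
  obtain ⟨𝒯, h𝒯3, h𝒯, h𝒯c⟩ := exists_triple_packing (6 * t + 2) hu
  obtain ⟨f, hf, hfr, hfl⟩ := exists_idempotent_quasigroup (6 * t + 2) (by omega) (by omega)
  obtain ⟨d, hd⟩ := exists_difference_triples s hs
  obtain ⟨𝒞, hcard, h3, hgrp, huniq, htrans⟩ :=
    exists_translation_invariant_packing 𝒯 f d h𝒯3 h𝒯 hf hfr hfl hd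
  have h𝒯t : 𝒯.card = t * (6 * t + 2) := by
    rw [show 6 * t + 2 - 2 = 6 * t by omega] at h𝒯c
    nlinarith
  let E : Fin (6 * t + 2) × ZMod (6 * s + 1) ≃ Fin (6 * t + 2) × Fin (6 * a + 5) × ZMod (6 * b + 5) :=
    Equiv.prodCongr (Equiv.refl _) e.symm
  have hE : ∀ B p, p ∈ Finset.image E B ↔ E.symm p ∈ B := fun B p => by
    simp [← E.eq_symm_apply]
  refine ⟨𝒞.image (Finset.image E), ?_, ?_, ?_, ?_, ?_⟩
  · rw [Finset.card_image_of_injective _ (Finset.image_injective E.injective), hcard, ZMod.card,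
      ← hvw, h𝒯t, Jstar_eq_s19 (by omega) hvw, show 6 * t + 2 - 1 = 6 * t + 1 by omega]
    ring
  · simp only [Finset.forall_mem_image]
    exact fun B hB => (Finset.card_image_of_injective _ E.injective).trans (h3 B hB)
  · simp only [Finset.forall_mem_image]
    exact fun B hB p hp q hq hpq => hgrp B hB p hp q hq (ne_of_apply_ne E hpq)
  · intro p q hpq
    have hne : E.symm p ≠ E.symm q := E.symm.injective.ne (ne_of_apply_ne Prod.fst hpq)
    refine Finset.card_le_one.2 fun B hB B' hB' => ?_
    simp only [Finset.mem_filter, Finset.mem_image (s := 𝒞)] at hB hB'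
    obtain ⟨⟨B, hB, rfl⟩, hp, hq⟩ := hB
    obtain ⟨⟨B', hB', rfl⟩, hp', hq'⟩ := hB'
    rw [huniq B hB B' hB' _ _ hne ((hE _ _).1 hp) ((hE _ _).1 hq) ((hE _ _).1 hp')
      ((hE _ _).1 hq')]
  · simp only [Finset.forall_mem_image]
    intro B hB
    refine Finset.mem_image.2 ⟨_, htrans B hB ((6 * a + 5 : ℕ) : ZMod (6 * s + 1)), ?_⟩
    rw [Finset.image_image, Finset.image_image]
    refine Finset.image_congr fun p _ => Prod.ext rfl ?_
    change e.symm (p.2 + _) = ((e.symm p.2).1, (e.symm p.2).2 + 1)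
    rw [e.symm_apply_eq, he, e.apply_symm_apply]
end
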